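/- arXiv:math/0404336 — 4 statements merged into one kernel-verified Lean document; each statement's English description precedes it below -/
import Mathlib

section
/- Let a < b, σ ∈ (0, (b−a)/2), and let z_1 < z_2 < … < z_p be real numbers with a + σ < z_1 and z_p < b − σ. Let X be the (p+2)-tuple (a, z_1, …, z_p, b) and Y the (p+2)-tuple (a+σ, z_1, …, z_p, b−σ). Then Y can be obtained from X by a finite sequence of simple nondegenerate contractions, i.e., there exist tuples X_0 = X, X_1, …, X_s = Y such that each X_{j+1} is obtained from X_j (with entries in increasing order) by replacing two consecutive entries u < v by u+t, v−t for some t ∈ (0, (v−u)/2). -/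
open Finset

/-- `y` is obtained from `x` (an `n`-tuple) by a simple nondegenerate contraction:
two consecutive entries `x k < x (k+1)` are replaced by `x k + t`, `x (k+1) - t`
with `t ∈ (0, (x (k+1) - x k)/2)`, all other entries (within range `n`) unchanged. -/
def SimpleNondegContraction (n : ℕ) (x y : ℕ → ℝ) : Prop :=
  ∃ k t : _, k + 1 < n ∧ (0 : ℝ) < t ∧ t < (x (k + 1) - x k) / 2 ∧
    y k = x k + t ∧ y (k + 1) = x (k + 1) - t ∧
    ∀ i < n, i ≠ k → i ≠ k + 1 → y i = x i

lemma chain_of_rtg {α : Type*} {R : α → α → Prop} {x y : α} (h : Relation.ReflTransGen R x y) :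
    ∃ (s : ℕ) (c : ℕ → α), c 0 = x ∧ c s = y ∧ ∀ j < s, R (c j) (c (j + 1)) := by
  induction h using Relation.ReflTransGen.head_induction_on with
  | refl => exact ⟨0, fun _ => y, rfl, rfl, by simp⟩
  | @head u v hab _ ih =>
    obtain ⟨s, c, h0, hs, hc⟩ := ih
    refine ⟨s + 1, fun j => Nat.casesOn j u c, rfl, hs, ?_⟩
    intro j hj
    cases j with
    | zero => simpa [h0] using hab
    | succ j => exact hc j (by omega)

lemma pass_rtg (n : ℕ) (x : ℕ → ℝ) (e : ℝ) (he : 0 < e)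
    (hx : ∀ i, i + 1 < n → 2 * e < x (i + 1) - x i) (k : ℕ) (hk : k + 1 < n) :
    Relation.ReflTransGen (SimpleNondegContraction n) x
      (fun i => if i = 0 then x 0 + e else if i = k + 1 then x i - e else x i) := by
  induction k with
  | zero =>
    apply Relation.ReflTransGen.single
    refine ⟨0, e, hk, he, by linarith [hx 0 hk], by simp, by simp, ?_⟩
    intro i _ h0 h1
    simp at h1
    simp [h0, h1]
  | succ k ih =>
    refine (ih (by omega)).tail ⟨k + 1, e, hk, he, ?_, by simp, by simp, ?_⟩
    · have := hx (k + 1) hk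
      simp
      linarith
    · intro i _ h0 h1
      simp [h0, h1]

lemma exists_gap (n : ℕ) (f : ℕ → ℝ) (hf : ∀ i < n, 0 < f i) :
    ∃ g > 0, ∀ i < n, g ≤ f i := by
  induction n with
  | zero => exact ⟨1, one_pos, by simp⟩
  | succ n ih =>
    obtain ⟨g, hg, h⟩ := ih (fun i hi => hf i (by omega))
    refine ⟨min g (f n), lt_min hg (hf n (by omega)), fun i hi => ?_⟩
    rcases Nat.lt_succ_iff_lt_or_eq.mp hi with h1 | rfl
    · exact (min_le_left _ _).trans (h i h1)
    · exact min_le_right _ _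

/-- endpoints moved inwards by `d` -/
noncomputable def shrinkEnds (p : ℕ) (x : ℕ → ℝ) (d : ℝ) : ℕ → ℝ :=
  fun i => if i = 0 then x 0 + d else if i = p + 1 then x i - d else x i

lemma shrinkEnds_gap (p : ℕ) (x : ℕ → ℝ) (d s : ℝ) (hd : d ≤ s) (i : ℕ) (hi : i < p + 1) :
    shrinkEnds p x s (i + 1) - shrinkEnds p x s i ≤
      shrinkEnds p x d (i + 1) - shrinkEnds p x d i := by
  unfold shrinkEnds
  have : i ≠ p + 1 := by omega
  simp only [this, if_false, Nat.succ_ne_zero]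
  split_ifs <;> subst_vars <;> linarith

/-- Lemma (c1): the tuple `(a+σ, z_1, …, z_p, b-σ)` can be obtained from
`(a, z_1, …, z_p, b)` by a finite sequence of simple nondegenerate contractions. -/
theorem contraction_chain_endpoints
    (a b σ : ℝ) (p : ℕ) (hp : 1 ≤ p) (z : ℕ → ℝ)
    (hab : a < b) (hσ0 : 0 < σ) (hσ : σ < (b - a) / 2)
    (hz : ∀ i, i + 1 < p → z i < z (i + 1))
    (hza : a + σ < z 0) (hzb : z (p - 1) < b - σ)
    (X Y : ℕ → ℝ)
    (hX0 : X 0 = a) (hXe : X (p + 1) = b) (hXz : ∀ i < p, X (i + 1) = z i)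
    (hY0 : Y 0 = a + σ) (hYe : Y (p + 1) = b - σ) (hYz : ∀ i < p, Y (i + 1) = z i) :
    ∃ (s : ℕ) (c : ℕ → ℕ → ℝ), c 0 = X ∧ (∀ i < p + 2, c s i = Y i) ∧
      ∀ j < s, SimpleNondegContraction (p + 2) (c j) (c (j + 1)) := by
  have hY : ∀ i < p + 2, shrinkEnds p X σ i = Y i := by
    intro i hi
    unfold shrinkEnds
    split_ifs with h0 h1
    · rw [h0, hY0, hX0]
    · rw [h1, hYe, hXe]
    · obtain ⟨j, rfl⟩ := Nat.exists_eq_succ_of_ne_zero h0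
      have hj : j < p := by omega
      exact (hXz j hj).trans (hYz j hj).symm
  have hgap : ∀ i < p + 1, 0 < Y (i + 1) - Y i := by
    intro i hi
    rcases Nat.eq_zero_or_pos i with rfl | h0
    · rw [hYz 0 hp, hY0]; linarith
    · obtain ⟨j, rfl⟩ := Nat.exists_eq_succ_of_ne_zero h0.ne'
      have hj : j < p := by omega
      have e1 : Y (j.succ) = z j := hYz j hj
      rw [e1]
      rcases Nat.lt_or_ge (j + 1) p with h | h
      · have e2 : Y (j.succ + 1) = z (j + 1) := hYz (j + 1) h
        rw [e2]; linarith [hz j h]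
      · have e3 : j = p - 1 := by omega
        have e2 : Y (j.succ + 1) = b - σ := by
          rw [← hYe]; congr 1; omega
        rw [e2, e3]; linarith
  obtain ⟨g, hg, hgY⟩ := exists_gap (p + 1) (fun i => Y (i + 1) - Y i) hgap
  obtain ⟨N, hN⟩ := exists_nat_gt (2 * σ / g)
  have hN0 : (0 : ℝ) < N := lt_trans (by positivity) hN
  have he : 2 * (σ / N) < g := by
    rw [div_lt_iff₀ hg] at hN
    rw [← mul_div_assoc, div_lt_iff₀ hN0]
    linarith
  have he0 : 0 < σ / N := by positivity
  have hNe : N * (σ / N) = σ := by field_simp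
  generalize σ / N = e at he he0 hNe
  have key : ∀ m : ℕ, m ≤ N →
      Relation.ReflTransGen (SimpleNondegContraction (p + 2)) X (shrinkEnds p X (m * e)) := by
    intro m
    induction m with
    | zero =>
      intro _
      have : shrinkEnds p X ((0 : ℕ) * e) = X := by
        funext i
        unfold shrinkEnds
        split_ifs <;> simp_all
      rw [this]
    | succ m ih =>
      intro hm
      have hle : (m : ℝ) * e ≤ σ := by
        rw [← hNe]
        have : (m : ℝ) ≤ N := by exact_mod_cast (by omega : m ≤ N)
        gcongr
      have h := pass_rtg (p + 2) (shrinkEnds p X (m * e)) e he0 (by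
        intro i hi
        have h1 := shrinkEnds_gap p X (m * e) σ hle i (by omega)
        rw [hY i (by omega), hY (i + 1) (by omega)] at h1
        have h2 := hgY i (by omega)
        linarith) p (by omega)
      refine (ih (by omega)).trans ?_
      convert h using 1
      funext i
      unfold shrinkEnds
      push_cast
      split_ifs <;> simp_all <;> ring
  obtain ⟨s, c, h0, hs, hc⟩ := chain_of_rtg (key N le_rfl)
  refine ⟨s, c, h0, ?_, hc⟩
  intro i hi
  rw [hs, hNe, hY i hi]
end

section
/- Let n ≥ 1 and let P, Q be monic hyperbolic polynomials of degree n (all roots real) such that the root multiset of Q is majorized by the root multiset of P. Then for every λ ∈ ℝ, the root multiset of Q − λQ′ is majorized by the root multiset of P − λP′. -/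
open Polynomial Finset

/-- Classical majorization of `n`-tuples via convex functions. -/
def MajorizedOn (n : ℕ) (x y : ℕ → ℝ) : Prop :=
  ∀ f : ℝ → ℝ, ConvexOn ℝ Set.univ f →
    ∑ i ∈ Finset.range n, f (x i) ≤ ∑ i ∈ Finset.range n, f (y i)


lemma convex_subgrad (f : ℝ → ℝ) (hf : ConvexOn ℝ Set.univ f) (m : ℝ) :
    ∃ c : ℝ, ∀ z, f m + c * (z - m) ≤ f z := by
  set S : Set ℝ := {s | ∃ a < m, s = (f m - f a) / (m - a)} with hS
  have key : ∀ a b, a < m → m < b → (f m - f a) / (m - a) ≤ (f b - f m) / (b - m) :=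
    fun a b ha hb => hf.slope_mono_adjacent (Set.mem_univ _) (Set.mem_univ _) ha hb
  have hne : S.Nonempty := ⟨_, m - 1, by linarith, rfl⟩
  have hb : BddAbove S := by
    refine ⟨(f (m+1) - f m) / (m + 1 - m), ?_⟩
    rintro s ⟨a, ha, rfl⟩
    exact key a _ ha (by linarith)
  refine ⟨sSup S, fun z => ?_⟩
  rcases lt_trichotomy z m with h | h | h
  · have := le_csSup hb (⟨z, h, rfl⟩ : (f m - f z) / (m - z) ∈ S)
    rw [div_le_iff₀ (by linarith)] at this
    linarith
  · subst h; simp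
  · have : sSup S ≤ (f z - f m) / (z - m) := by
      apply csSup_le hne
      rintro s ⟨a, ha, rfl⟩
      exact key a _ ha h
    rw [le_div_iff₀ (by linarith)] at this
    linarith

/-- If `v` is obtained from `u` by moving all entries toward `m`, with the same sum, it is majorized. -/
lemma maj_of_spread (n : ℕ) (u v : ℕ → ℝ) (m : ℝ)
    (hsum : ∑ i ∈ range n, u i = ∑ i ∈ range n, v i)
    (h1 : ∀ i < n, m < v i → v i ≤ u i)
    (h2 : ∀ i < n, v i < m → u i ≤ v i) : MajorizedOn n v u := by
  intro f hf
  obtain ⟨c, hc⟩ := convex_subgrad f hf m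
  have key : ∀ i ∈ range n, c * (u i - v i) ≤ f (u i) - f (v i) := by
    intro i hi
    have hi := Finset.mem_range.1 hi
    rcases lt_trichotomy (v i) m with h | h | h
    · rcases eq_or_lt_of_le (h2 i hi h) with e | e
      · rw [e]; simp
      · have := hf.slope_mono_adjacent (Set.mem_univ _) (Set.mem_univ _) e h
        have h3 := hc (v i)
        have h4 : (f m - f (v i)) / (m - v i) ≤ c := by
          rw [div_le_iff₀ (by linarith)]; linarith
        have h5 := this.trans h4
        rw [div_le_iff₀ (by linarith)] at h5
        linarith
    · rw [h]; have := hc (u i); linarith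
    · rcases eq_or_lt_of_le (h1 i hi h) with e | e
      · rw [e]; simp
      · have := hf.slope_mono_adjacent (Set.mem_univ _) (Set.mem_univ _) h e
        have h3 := hc (v i)
        have h4 : c ≤ (f (v i) - f m) / (v i - m) := by
          rw [le_div_iff₀ (by linarith)]; linarith
        have h5 := h4.trans this
        rw [le_div_iff₀ (by linarith)] at h5
        linarith
  have := Finset.sum_le_sum key
  rw [← Finset.mul_sum, Finset.sum_sub_distrib, Finset.sum_sub_distrib, hsum] at this
  linarith

/-- The polynomial with roots `x 0, …, x (n-1)`. -/
noncomputable def rp (n : ℕ) (x : ℕ → ℝ) : ℝ[X] := ∏ i ∈ range n, (X - C (x i))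

/-- The pencil. -/
noncomputable def pen (n : ℕ) (lam : ℝ) (x : ℕ → ℝ) : ℝ[X] :=
  rp n x - C lam * derivative (rp n x)

lemma rp_monic (n : ℕ) (x : ℕ → ℝ) : (rp n x).Monic := monic_prod_X_sub_C _ _

lemma rp_natDegree (n : ℕ) (x : ℕ → ℝ) : (rp n x).natDegree = n := by
  simp [rp, natDegree_finsetProd_X_sub_C_eq_card]

lemma rp_roots (n : ℕ) (x : ℕ → ℝ) : (rp n x).roots = (range n).val.map x := by
  have : rp n x = (((range n).val.map x).map fun a => X - C a).prod := by
    simp [rp, Finset.prod]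
  rw [this, roots_multiset_prod_X_sub_C]

lemma rp_eval (n : ℕ) (x : ℕ → ℝ) (t : ℝ) :
    (rp n x).eval t = ∏ i ∈ range n, (t - x i) := by
  simp [rp, eval_prod]

lemma rp_deriv_eval (n : ℕ) (x : ℕ → ℝ) (t : ℝ) (h : ∀ i < n, t ≠ x i) :
    (derivative (rp n x)).eval t = (rp n x).eval t * ∑ i ∈ range n, 1 / (t - x i) := by
  induction n with
  | zero => simp [rp]
  | succ n ih =>
    have ih := ih (fun i hi => h i (by omega))
    have hs : rp (n+1) x = rp n x * (X - C (x n)) := by simp [rp, Finset.prod_range_succ]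
    have hn : t - x n ≠ 0 := sub_ne_zero.2 (h n (by omega))
    rw [hs, Finset.sum_range_succ]
    simp only [derivative_mul, derivative_sub, derivative_X, derivative_C, eval_add, eval_mul,
      eval_sub, eval_X, eval_C, eval_one, sub_zero, ih]
    field_simp

lemma pen_eval (n : ℕ) (lam : ℝ) (x : ℕ → ℝ) (t : ℝ) (h : ∀ i < n, t ≠ x i) :
    (pen n lam x).eval t = (rp n x).eval t * (1 - lam * ∑ i ∈ range n, 1 / (t - x i)) := by
  simp only [pen, eval_sub, eval_mul, eval_C, rp_deriv_eval n x t h]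
  ring

lemma pen_deg_aux (n : ℕ) (lam : ℝ) (x : ℕ → ℝ) :
    (C lam * derivative (rp n x)).degree < (rp n x).degree := by
  have h0 : (rp n x) ≠ 0 := (rp_monic n x).ne_zero
  rw [C_mul']
  refine lt_of_le_of_lt (degree_smul_le lam _) ?_
  exact degree_derivative_lt h0

lemma pen_monic (n : ℕ) (hn : 1 ≤ n) (lam : ℝ) (x : ℕ → ℝ) : (pen n lam x).Monic :=
  (rp_monic n x).sub_of_left (pen_deg_aux n lam x)

lemma pen_natDegree (n : ℕ) (hn : 1 ≤ n) (lam : ℝ) (x : ℕ → ℝ) : (pen n lam x).natDegree = n := by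
  have := degree_sub_eq_left_of_degree_lt (pen_deg_aux n lam x)
  rw [pen, natDegree_eq_of_degree_eq this, rp_natDegree]

lemma pen_sum (n : ℕ) (hn : 1 ≤ n) (lam : ℝ) (x u : ℕ → ℝ) (h : pen n lam x = rp n u) :
    ∑ i ∈ range n, u i = ∑ i ∈ range n, x i + lam * n := by
  have hc : ∀ z : ℕ → ℝ, (rp n z).coeff (n-1) = - ∑ i ∈ range n, z i := by
    intro z
    have := prod_X_sub_C_coeff_card_pred (range n) z (by simp; omega)
    simpa [rp] using this
  have h1 := congrArg (fun p => p.coeff (n-1)) h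
  simp only [pen, coeff_sub, coeff_C_mul, coeff_derivative, hc] at h1
  have h2 : (rp n x).coeff (n - 1 + 1) = 1 := by
    have := (rp_monic n x).coeff_natDegree
    rw [rp_natDegree] at this
    rwa [Nat.sub_add_cancel hn]
  rw [h2] at h1
  have h3 : ((n - 1 : ℕ) : ℝ) + 1 = n := by
    rw [← Nat.cast_add_one, Nat.sub_add_cancel hn]
  rw [h3] at h1
  linarith

lemma sign_prod (n : ℕ) (z : ℕ → ℝ) (t : ℝ) (i : ℕ) (hi : i ≤ n)
    (h1 : ∀ l < i, t < z l) (h2 : ∀ l < n, i ≤ l → z l < t) :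
    0 < (-1 : ℝ)^i * (rp n z).eval t := by
  rw [rp_eval, ← Finset.prod_range_mul_prod_Ico _ hi, ← mul_assoc]
  have e : (-1 : ℝ)^i = ∏ l ∈ range i, (-1 : ℝ) := by simp
  rw [e, ← Finset.prod_mul_distrib]
  apply mul_pos
  · apply Finset.prod_pos
    intro l hl
    have := h1 l (Finset.mem_range.1 hl)
    linarith
  · apply Finset.prod_pos
    intro l hl
    rw [Finset.mem_Ico] at hl
    have := h2 l hl.2 hl.1
    linarith

/-- Root strictly between two distinct consecutive roots. -/
lemma pen_gap (n : ℕ) (lam : ℝ) (hl : 0 < lam) (x : ℕ → ℝ) (a b : ℝ) (hab : a < b)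
    (ha : (rp n x).eval a = 0) (hb : (rp n x).eval b = 0) :
    ∃ c, a < c ∧ c < b ∧ (pen n lam x).eval c = 0 := by
  have hd : ∀ t : ℝ, HasDerivAt (fun t => Real.exp (-t / lam) * (rp n x).eval t)
      (Real.exp (-t / lam) * (-1 / lam) * (rp n x).eval t
        + Real.exp (-t / lam) * (derivative (rp n x)).eval t) t := by
    intro t
    exact (((hasDerivAt_id t).neg.div_const lam).exp).mul ((rp n x).hasDerivAt t)
  obtain ⟨c, hc, hc0⟩ := exists_hasDerivAt_eq_zero hab
    (fun t _ => (hd t).continuousAt.continuousWithinAt) (by simp [ha, hb]) (fun t _ => hd t)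
  refine ⟨c, hc.1, hc.2, ?_⟩
  have he := Real.exp_pos (-c / lam)
  have h2 : Real.exp (-c / lam) * ((-1 / lam) * (rp n x).eval c
      + (derivative (rp n x)).eval c) = 0 := by rw [← hc0]; ring
  have h3 := (mul_eq_zero.1 h2).resolve_left he.ne'
  simp only [pen, eval_sub, eval_mul, eval_C]
  field_simp at h3
  linarith

/-- Root beyond the largest root. -/
lemma pen_top (n : ℕ) (hn : 1 ≤ n) (lam : ℝ) (hl : 0 < lam) (x : ℕ → ℝ) (hx : Antitone x) :
    ∃ c, x 0 < c ∧ (pen n lam x).eval c = 0 := by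
  have hne : ∀ t, x 0 < t → ∀ i < n, t ≠ x i := by
    intro t ht i _ h
    have := hx (Nat.zero_le i)
    linarith
  have hpos : ∀ t, x 0 < t → 0 < (rp n x).eval t := by
    intro t ht
    rw [rp_eval]
    apply Finset.prod_pos
    intro i _
    have := hx (Nat.zero_le i)
    linarith
  have h1 : (pen n lam x).eval (x 0 + lam / 2) ≤ 0 := by
    have ht : x 0 < x 0 + lam / 2 := by linarith
    rw [pen_eval _ _ _ _ (hne _ ht)]
    apply mul_nonpos_of_nonneg_of_nonpos (hpos _ ht).le
    have : 1 / (x 0 + lam / 2 - x 0) ≤ ∑ i ∈ range n, 1 / (x 0 + lam / 2 - x i) := by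
      apply Finset.single_le_sum (f := fun i => 1 / (x 0 + lam / 2 - x i)) _
        (Finset.mem_range.2 (show 0 < n by omega))
      intro i _
      have := hx (Nat.zero_le i)
      apply div_nonneg zero_le_one
      linarith
    have h2 := mul_le_mul_of_nonneg_left this hl.le
    have h3 : lam * (1 / (x 0 + lam / 2 - x 0)) = 2 := by
      rw [add_sub_cancel_left]; field_simp
    linarith
  have h2 : 0 ≤ (pen n lam x).eval (x 0 + (lam / 2 + n * lam)) := by
    have hn' : (1 : ℝ) ≤ n := by exact_mod_cast hn
    have hnl : 0 < (n : ℝ) * lam := by positivity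
    have ht : x 0 < x 0 + (lam / 2 + n * lam) := by linarith
    rw [pen_eval _ _ _ _ (hne _ ht)]
    apply mul_nonneg (hpos _ ht).le
    have : ∑ i ∈ range n, 1 / (x 0 + (lam / 2 + n * lam) - x i) ≤ ∑ i ∈ range n, 1 / (n * lam) := by
      apply Finset.sum_le_sum
      intro i _
      have := hx (Nat.zero_le i)
      apply one_div_le_one_div_of_le hnl
      linarith
    have h2 := mul_le_mul_of_nonneg_left this hl.le
    have h3 : lam * ∑ i ∈ range n, 1 / (n * lam) = 1 := by
      simp
      field_simp
    linarith
  have hle : x 0 + lam / 2 ≤ x 0 + (lam / 2 + n * lam) := by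
    have : 0 ≤ (n : ℝ) * lam := by positivity
    linarith
  obtain ⟨c, hc, hc0⟩ := intermediate_value_Icc hle
    ((pen n lam x).continuous.continuousOn) (show (0:ℝ) ∈ _ from ⟨h1, h2⟩)
  exact ⟨c, by linarith [hc.1], hc0⟩

/-- Hermite-Poulain with interlacing. -/
lemma pen_roots (n : ℕ) (hn : 1 ≤ n) (lam : ℝ) (hl : 0 < lam) (x : ℕ → ℝ) (hx : Antitone x) :
    ∃ u : ℕ → ℝ, pen n lam x = rp n u ∧ (∀ i < n, x i ≤ u i) ∧
      (∀ i, i + 1 < n → u (i+1) ≤ x i) := by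
  have hroot : ∀ i < n, (rp n x).eval (x i) = 0 := by
    intro i hi
    rw [rp_eval]
    exact Finset.prod_eq_zero (Finset.mem_range.2 hi) (sub_self _)
  have hex : ∀ i, ∃ c, i < n → (x i ≤ c ∧ (1 ≤ i → c ≤ x (i-1)) ∧
      ((1 ≤ i ∧ x i = x (i-1) ∧ c = x i) ∨
        ((∀ j < n, c ≠ x j) ∧ (pen n lam x).eval c = 0))) := by
    intro i
    by_cases hi : i < n
    swap
    · exact ⟨0, fun h => absurd h hi⟩
    rcases Nat.eq_zero_or_pos i with h0 | h0
    · subst h0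
      obtain ⟨c, hc, hc0⟩ := pen_top n hn lam hl x hx
      refine ⟨c, fun _ => ⟨hc.le, fun h => by omega, Or.inr ⟨fun j _ h => ?_, hc0⟩⟩⟩
      have := hx (Nat.zero_le j)
      linarith
    · by_cases he : x i = x (i-1)
      · exact ⟨x i, fun _ => ⟨le_rfl, fun _ => he.le, Or.inl ⟨h0, he, rfl⟩⟩⟩
      · have hlt : x i < x (i-1) := lt_of_le_of_ne (hx (Nat.sub_le i 1)) he
        obtain ⟨c, h1, h2, hc0⟩ := pen_gap n lam hl x _ _ hlt (hroot i hi)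
          (hroot (i-1) (by omega))
        refine ⟨c, fun _ => ⟨h1.le, fun _ => h2.le, Or.inr ⟨fun j _ h => ?_, hc0⟩⟩⟩
        rcases le_or_gt i j with hj | hj
        · have := hx hj
          linarith
        · have := hx (show j ≤ i - 1 by omega)
          linarith
  choose u hu using hex
  have hp0 : pen n lam x ≠ 0 := (pen_monic n hn lam x).ne_zero
  have hle : (range n).val.map u ≤ (pen n lam x).roots := by
    rw [Multiset.le_iff_count]
    intro r
    rw [count_roots, Multiset.count_map, ← Finset.filter_val, Finset.card_val]
    by_cases hr : ∃ j < n, r = x j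
    · obtain ⟨j, hj, rfl⟩ := hr
      set S := (range n).filter (fun i => x j = x i) with hS
      have hjS : j ∈ S := by simp [hS, hj]
      have hSne : S.Nonempty := ⟨j, hjS⟩
      have hsub : (range n).filter (fun i => x j = u i) ⊆ S.erase (S.min' hSne) := by
        intro i hi
        simp only [Finset.mem_filter, Finset.mem_range] at hi
        obtain ⟨hin, hiu⟩ := hi
        rcases (hu i hin).2.2 with ⟨h1, h2, h3⟩ | ⟨h1, _⟩
        · rw [Finset.mem_erase]
          have hi1 : i - 1 ∈ S := by
            simp only [hS, Finset.mem_filter, Finset.mem_range]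
            exact ⟨by omega, by rw [hiu, h3, h2]⟩
          have := S.min'_le _ hi1
          refine ⟨by omega, ?_⟩
          simp only [hS, Finset.mem_filter, Finset.mem_range]
          exact ⟨hin, by rw [hiu, h3]⟩
        · exact absurd hiu.symm (h1 j hj)
      have hcard := Finset.card_le_card hsub
      rw [Finset.card_erase_of_mem (Finset.min'_mem _ _)] at hcard
      refine hcard.trans ?_
      rw [le_rootMultiplicity_iff hp0]
      have hdvd : (X - C (x j)) ^ S.card ∣ rp n x := by
        rw [rp]
        have : (X - C (x j)) ^ S.card = ∏ i ∈ S, (X - C (x i)) := by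
          rw [← Finset.prod_const]
          apply Finset.prod_congr rfl
          intro i hi
          rw [(Finset.mem_filter.1 hi).2]
        rw [this]
        exact Finset.prod_dvd_prod_of_subset _ _ _ (Finset.filter_subset _ _)
      have hd := pow_sub_one_dvd_derivative_of_pow_dvd hdvd
      exact dvd_sub ((pow_dvd_pow _ (Nat.sub_le _ _)).trans hdvd) (hd.mul_left _)
    · push Not at hr
      have hgood : ∀ i < n, r = u i → (pen n lam x).eval r = 0 := by
        intro i hi h
        rcases (hu i hi).2.2 with ⟨_, _, h3⟩ | ⟨_, h2⟩
        · exact absurd (h.trans h3) (hr i hi)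
        · rw [h]; exact h2
      rcases Finset.eq_empty_or_nonempty ((range n).filter (fun i => r = u i)) with h | ⟨i, hi⟩
      · rw [h]; simp
      · have h1 : ((range n).filter (fun i => r = u i)).card ≤ 1 := by
          rw [Finset.card_le_one]
          have aux : ∀ a b, b < n → a < b → r = u a → r = u b → False := by
            intro a b hb hab h1 h2
            have h3 := (hu b hb).2.1 (by omega)
            have h4 := (hu a (by omega)).1
            have h5 := hx (show a ≤ b - 1 by omega)
            exact hr a (by omega) (by linarith)
          intro a ha b hb
          simp only [Finset.mem_filter, Finset.mem_range] at ha hb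
          rcases lt_trichotomy a b with h | h | h
          · exact (aux a b hb.1 h ha.2 hb.2).elim
          · exact h
          · exact (aux b a ha.1 h hb.2 ha.2).elim
        refine h1.trans ?_
        simp only [Finset.mem_filter, Finset.mem_range] at hi
        exact (rootMultiplicity_pos hp0).2 (hgood i hi.1 hi.2)
  have hcard : (pen n lam x).roots.card ≤ n := by
    have := card_roots' (pen n lam x)
    rwa [pen_natDegree n hn] at this
  have heq : (range n).val.map u = (pen n lam x).roots :=
    Multiset.eq_of_le_of_card_le hle (by simpa using hcard)
  refine ⟨u, ?_, fun i hi => (hu i hi).1, fun i hi => ?_⟩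
  · have := prod_multiset_X_sub_C_of_monic_of_roots_card_eq (pen_monic n hn lam x)
      (by rw [← heq, pen_natDegree n hn]; simp)
    rw [← this, ← heq]
    simp [rp, Finset.prod]
  · exact (hu (i+1) hi).2.1 (by omega)

lemma g_diff (n : ℕ) (x x' : ℕ → ℝ) (j k : ℕ) (hjk : j < k) (hk : k < n)
    (δ : ℝ) (hj' : x' j = x j - δ) (hk' : x' k = x k + δ)
    (ho : ∀ i, i ≠ j → i ≠ k → x' i = x i) (t : ℝ)
    (h1 : 0 < (t - x j) * (t - x' j)) (h2 : 0 < (t - x k) * (t - x' k)) :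
    ∑ i ∈ range n, 1 / (t - x i) - ∑ i ∈ range n, 1 / (t - x' i)
      = (t - (x j + x k) / 2) * (2 * δ * (x j - x' k) /
        (((t - x j) * (t - x' j)) * ((t - x k) * (t - x' k)))) := by
  rw [← Finset.sum_sub_distrib]
  have hs : ∑ i ∈ ({j, k} : Finset ℕ), (1 / (t - x i) - 1 / (t - x' i))
      = ∑ i ∈ range n, (1 / (t - x i) - 1 / (t - x' i)) := by
    apply Finset.sum_subset
    · intro i hi
      simp only [Finset.mem_insert, Finset.mem_singleton] at hi
      rw [Finset.mem_range]; omega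
    · intro i _ hi
      simp only [Finset.mem_insert, Finset.mem_singleton, not_or] at hi
      rw [ho i hi.1 hi.2, sub_self]
  rw [← hs, Finset.sum_pair hjk.ne]
  have a1 : t - x j ≠ 0 := fun h => by simp [h] at h1
  have a2 : t - x' j ≠ 0 := fun h => by simp [h] at h1
  have a3 : t - x k ≠ 0 := fun h => by simp [h] at h2
  have a4 : t - x' k ≠ 0 := fun h => by simp [h] at h2
  rw [hj'] at a2 ⊢
  rw [hk'] at a4 ⊢
  field_simp
  ring

lemma transfer_step (n : ℕ) (hn : 1 ≤ n) (lam : ℝ) (hl : 0 < lam) (x x' : ℕ → ℝ)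
    (hx : Antitone x) (hx' : Antitone x') (j k : ℕ) (hjk : j < k) (hk : k < n)
    (δ : ℝ) (hδ : 0 ≤ δ) (hj' : x' j = x j - δ) (hk' : x' k = x k + δ)
    (ho : ∀ i, i ≠ j → i ≠ k → x' i = x i) (u v : ℕ → ℝ)
    (hu : pen n lam x = rp n u) (hu1 : ∀ i < n, x i ≤ u i) (hu2 : ∀ i, i + 1 < n → u (i+1) ≤ x i)
    (hv : pen n lam x' = rp n v) (hv1 : ∀ i < n, x' i ≤ v i)
    (hv2 : ∀ i, i + 1 < n → v (i+1) ≤ x' i) :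
    MajorizedOn n v u := by
  have hanti : ∀ (z w : ℕ → ℝ), Antitone z → (∀ i < n, z i ≤ w i) →
      (∀ i, i + 1 < n → w (i+1) ≤ z i) → ∀ a b, a ≤ b → b < n → w b ≤ w a := by
    intro z w hz h1 h2 a b hab hb
    rcases eq_or_lt_of_le hab with rfl | hab
    · exact le_rfl
    · have h3 := h2 (b-1) (by omega)
      rw [Nat.sub_add_cancel (by omega)] at h3
      have h4 := hz (show a ≤ b - 1 by omega)
      have h5 := h1 a (by omega)
      linarith
  have hua := hanti x u hx hu1 hu2
  have hva := hanti x' v hx' hv1 hv2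
  have hjk' := hx' hjk.le
  have hm1 : (x j + x k) / 2 ≤ x' j := by linarith
  have hm2 : x' k ≤ (x j + x k) / 2 := by linarith
  have hnn : 0 ≤ x j - x' k := by linarith
  have hge : ∀ i, i ≠ k → x' i ≤ x i := by
    intro i hi
    by_cases h : i = j
    · subst h; linarith
    · exact (ho i h hi).le
  have hle : ∀ i, i ≠ j → x i ≤ x' i := by
    intro i hi
    by_cases h : i = k
    · subst h; linarith
    · exact (ho i hi h).ge
  -- the common sign argument
  have core : ∀ (t : ℝ) (i : ℕ), i < n → (∀ l < i, t < x l) → (∀ l < n, i ≤ l → x l < t) →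
      (∀ l < i, t < x' l) → (∀ l < n, i ≤ l → x' l < t) →
      ∃ c : ℝ, 0 ≤ c ∧ ∃ gx gx' : ℝ, gx - gx' = (t - (x j + x k) / 2) * c ∧
        (0 < (-1:ℝ)^i * (rp n u).eval t ↔ lam * gx < 1) ∧
        (0 < (-1:ℝ)^i * (rp n v).eval t ↔ lam * gx' < 1) := by
    intro t i hi a1 a2 b1 b2
    have na : ∀ l < n, t ≠ x l := by
      intro l hln
      rcases lt_or_ge l i with h | h
      · exact (a1 l h).ne
      · exact (a2 l hln h).ne'
    have nb : ∀ l < n, t ≠ x' l := by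
      intro l hln
      rcases lt_or_ge l i with h | h
      · exact (b1 l h).ne
      · exact (b2 l hln h).ne'
    have hsame : ∀ l < n, 0 < (t - x l) * (t - x' l) := by
      intro l hln
      rcases lt_or_ge l i with h | h
      · exact mul_pos_of_neg_of_neg (by linarith [a1 l h]) (by linarith [b1 l h])
      · exact mul_pos (by linarith [a2 l hln h]) (by linarith [b2 l hln h])
    have sx := sign_prod n x t i hi.le a1 a2
    have sx' := sign_prod n x' t i hi.le b1 b2
    refine ⟨_, ?_, _, _, g_diff n x x' j k hjk hk δ hj' hk' ho t (hsame j (by omega)) (hsame k hk),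
      ?_, ?_⟩
    · exact div_nonneg (by positivity) (mul_pos (hsame j (by omega)) (hsame k hk)).le
    · rw [← hu, pen_eval n lam x t na, ← mul_assoc, mul_pos_iff_of_pos_left sx, sub_pos]
    · rw [← hv, pen_eval n lam x' t nb, ← mul_assoc, mul_pos_iff_of_pos_left sx', sub_pos]
  have neg_of : ∀ (z : ℕ → ℝ) (t : ℝ) (i : ℕ), i < n → (∀ l < i + 1, t < z l) →
      (∀ l < n, i + 1 ≤ l → z l < t) → ¬ 0 < (-1:ℝ)^i * (rp n z).eval t := by
    intro z t i hi h1 h2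
    have := sign_prod n z t (i+1) hi h1 h2
    rw [pow_succ] at this
    intro h
    linarith
  refine maj_of_spread n u v ((x j + x k) / 2) ?_ ?_ ?_
  · rw [pen_sum n hn lam x u hu, pen_sum n hn lam x' v hv]
    have h1 := Finset.sum_subset (s₁ := ({j, k} : Finset ℕ)) (s₂ := range n)
      (f := fun i => x i - x' i) (by
        intro i hi
        simp only [Finset.mem_insert, Finset.mem_singleton] at hi
        rw [Finset.mem_range]; omega) (by
        intro i _ hi
        simp only [Finset.mem_insert, Finset.mem_singleton, not_or] at hi
        rw [ho i hi.1 hi.2, sub_self])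
    rw [Finset.sum_pair hjk.ne, Finset.sum_sub_distrib] at h1
    linarith
  · intro i hi hmv
    by_contra hlt
    push Not at hlt
    obtain ⟨t, ht1, ht2⟩ := exists_between (max_lt hmv hlt)
    have hmt := (le_max_left _ _).trans_lt ht1
    have hut := (le_max_right _ _).trans_lt ht1
    have b1 : ∀ l < i, t < x' l := by
      intro l hli
      have h3 := hv2 (i-1) (by omega)
      rw [Nat.sub_add_cancel (by omega)] at h3
      have := hx' (show l ≤ i - 1 by omega)
      linarith
    have a1 : ∀ l < i, t < x l := by
      intro l hli
      have h3 := b1 l hli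
      have h4 := hge l (fun h => by subst h; linarith)
      linarith
    have a2 : ∀ l < n, i ≤ l → x l < t := by
      intro l _ h
      have := hx h
      have := hu1 i hi
      linarith
    have b2 : ∀ l < n, i ≤ l → x' l < t := by
      intro l hln h
      by_cases hlk : l = k
      · subst hlk; linarith
      · have := hge l hlk
        have := a2 l hln h
        linarith
    obtain ⟨c, hc, gx, gx', hg, e1, e2⟩ := core t i hi a1 a2 b1 b2
    have p1 := e1.1 (sign_prod n u t i hi.le
      (fun l hli => (a1 l hli).trans_le (hu1 l (by omega)))
      (fun l hln h => (hua i l h hln).trans_lt hut))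
    have p2 : ¬ lam * gx' < 1 := fun h => neg_of v t i hi
      (fun l hli => ht2.trans_le (hva l i (by omega) hi))
      (fun l hln h => by
        have h3 := hv2 (l-1) (by omega)
        rw [Nat.sub_add_cancel (by omega)] at h3
        exact h3.trans_lt (b2 (l-1) (by omega) (by omega))) (e2.2 h)
    have : 0 ≤ gx - gx' := by rw [hg]; exact mul_nonneg (by linarith) hc
    nlinarith
  · intro i hi hmv
    by_contra hlt
    push Not at hlt
    obtain ⟨t, ht1, ht2⟩ := exists_between (lt_min hmv hlt)
    have hmt := ht2.trans_le (min_le_left _ _)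
    have hut := ht2.trans_le (min_le_right _ _)
    have a1 : ∀ l < i, t < x l := by
      intro l hli
      have h3 := hu2 (i-1) (by omega)
      rw [Nat.sub_add_cancel (by omega)] at h3
      have := hx (show l ≤ i - 1 by omega)
      linarith
    have b1 : ∀ l < i, t < x' l := by
      intro l hli
      by_cases hlj : l = j
      · subst hlj; linarith
      · have := hle l hlj
        have := a1 l hli
        linarith
    have b2 : ∀ l < n, i ≤ l → x' l < t := by
      intro l _ h
      have := hx' h
      have := hv1 i hi
      linarith
    have a2 : ∀ l < n, i ≤ l → x l < t := by
      intro l hln h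
      have h3 := b2 l hln h
      have h4 := hle l (fun h => by subst h; linarith)
      linarith
    obtain ⟨c, hc, gx, gx', hg, e1, e2⟩ := core t i hi a1 a2 b1 b2
    have p1 := e2.1 (sign_prod n v t i hi.le
      (fun l hli => (b1 l hli).trans_le (hv1 l (by omega)))
      (fun l hln h => (hva i l h hln).trans_lt ht1))
    have p2 : ¬ lam * gx < 1 := fun h => neg_of u t i hi
      (fun l hli => hut.trans_le (hua l i (by omega) hi))
      (fun l hln h => by
        have h3 := hu2 (l-1) (by omega)
        rw [Nat.sub_add_cancel (by omega)] at h3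
        exact h3.trans_lt (a2 (l-1) (by omega) (by omega))) (e1.2 h)
    have : gx - gx' ≤ 0 := by
      rw [hg]; exact mul_nonpos_of_nonpos_of_nonneg (by linarith) hc
    nlinarith

lemma rp_unique (n : ℕ) (u v : ℕ → ℝ) (h : rp n u = rp n v) (f : ℝ → ℝ) :
    ∑ i ∈ range n, f (u i) = ∑ i ∈ range n, f (v i) := by
  have h1 : (range n).val.map u = (range n).val.map v := by
    rw [← rp_roots, ← rp_roots, h]
  have h2 := congrArg (fun s => (Multiset.map f s).sum) h1
  simpa [Finset.sum, Multiset.map_map] using h2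

lemma pen_congr_of_eq (n : ℕ) (lam : ℝ) (x y : ℕ → ℝ) (h : ∀ i < n, x i = y i) :
    pen n lam x = pen n lam y := by
  have : rp n x = rp n y := by
    unfold rp
    exact Finset.prod_congr rfl (fun i hi => by rw [h i (Finset.mem_range.1 hi)])
  unfold pen
  rw [this]

/-- Chain of transfers. -/
lemma chain (n : ℕ) (hn : 1 ≤ n) (lam : ℝ) (hl : 0 < lam) (y : ℕ → ℝ) (hy : Antitone y) (N : ℕ) :
    ∀ x : ℕ → ℝ, Antitone x → ((range n).filter (fun i => x i ≠ y i)).card ≤ N →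
      (∀ k ≤ n, ∑ i ∈ range k, y i ≤ ∑ i ∈ range k, x i) →
      ∑ i ∈ range n, y i = ∑ i ∈ range n, x i →
      ∀ u v : ℕ → ℝ, pen n lam x = rp n u → pen n lam y = rp n v → MajorizedOn n v u := by
  induction N with
  | zero =>
    intro x hx hN _ _ u v hu hv f _
    rw [Nat.le_zero, Finset.card_eq_zero, Finset.filter_eq_empty_iff] at hN
    have := pen_congr_of_eq n lam x y (fun i hi => by
      have := hN (Finset.mem_range.2 hi); simpa using this)
    rw [hu, hv] at this
    exact (rp_unique n u v this f).ge
  | succ N ih =>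
    intro x hx hN hpart htot u v hu hv
    by_cases hall : ∀ i < n, x i ≤ y i
    · have heq : ∀ i ∈ range n, x i = y i :=
        (Finset.sum_eq_sum_iff_of_le (fun i hi => hall i (Finset.mem_range.1 hi))).1 htot.symm
      have := pen_congr_of_eq n lam x y (fun i hi => heq i (Finset.mem_range.2 hi))
      rw [hu, hv] at this
      intro f _
      exact (rp_unique n u v this f).ge
    push Not at hall
    obtain ⟨i0, hi0, hi0'⟩ := hall
    set J := (range n).filter (fun i => y i < x i) with hJ
    have hJne : J.Nonempty := ⟨i0, by simp [hJ, hi0, hi0']⟩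
    obtain ⟨j, hjJ, hjmax⟩ := Finset.exists_max_image J id hJne
    simp only [hJ, Finset.mem_filter, Finset.mem_range, id] at hjJ hjmax
    obtain ⟨hjn, hjlt⟩ := hjJ
    have hafter : ∀ i < n, j < i → x i ≤ y i := by
      intro i hi hji
      by_contra h
      push Not at h
      have := hjmax i ⟨hi, h⟩
      omega
    have hpj := hpart j hjn.le
    have hexk : ∃ k, j < k ∧ k < n ∧ x k < y k := by
      by_contra hno
      push Not at hno
      have h1 := Finset.sum_range_add_sum_Ico x (show j + 1 ≤ n from hjn)
      have h2 := Finset.sum_range_add_sum_Ico y (show j + 1 ≤ n from hjn)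
      have h3 : ∑ i ∈ Finset.Ico (j+1) n, y i ≤ ∑ i ∈ Finset.Ico (j+1) n, x i := by
        apply Finset.sum_le_sum
        intro i hi
        rw [Finset.mem_Ico] at hi
        exact hno i (by omega) hi.2
      rw [Finset.sum_range_succ] at h1 h2
      linarith
    classical
    set k := Nat.find hexk with hkdef
    obtain ⟨hjk, hkn, hklt⟩ := Nat.find_spec hexk
    rw [← hkdef] at hjk hkn hklt
    have hmid : ∀ i, j < i → i < k → x i = y i := by
      intro i h1 h2
      have h3 := Nat.find_min hexk h2
      push Not at h3
      exact le_antisymm (hafter i (by omega) h1) (h3 h1 (by omega))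
    clear_value k
    set δ := min (x j - y j) (y k - x k) with hδ
    have hδ1 : δ ≤ x j - y j := min_le_left _ _
    have hδ2 : δ ≤ y k - x k := min_le_right _ _
    have hδ0 : 0 < δ := lt_min (by linarith) (by linarith)
    have hδc : δ = x j - y j ∨ δ = y k - x k := min_choice _ _
    clear_value δ
    set x' : ℕ → ℝ := fun i => if i = j then x j - δ else if i = k then x k + δ else x i with hx'
    have ej : x' j = x j - δ := by simp [hx']
    have ek : x' k = x k + δ := by simp [hx', hjk.ne']
    have eo : ∀ i, i ≠ j → i ≠ k → x' i = x i := by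
      intro i h1 h2; simp [hx', h1, h2]
    clear_value x'
    have hanti' : Antitone x' := by
      apply antitone_nat_of_succ_le
      intro i
      have hxi := hx (Nat.le_succ i)
      have hyi := hy (Nat.le_succ i)
      simp only [Nat.succ_eq_add_one] at hxi hyi
      by_cases h1 : i = j
      · subst h1
        by_cases h2 : i + 1 = k
        · subst h2; linarith
        · rw [ej, eo _ (by omega) h2, hmid _ (by omega) (by omega)]; linarith
      · by_cases h2 : i = k
        · subst h2
          rw [ek, eo _ (by omega) (by omega)]; linarith
        · rw [eo i h1 h2]
          by_cases h3 : i + 1 = j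
          · rw [h3] at hxi ⊢; linarith
          · by_cases h4 : i + 1 = k
            · rw [h4] at hxi hyi ⊢
              rw [hmid i (by omega) (by omega)]; linarith
            · rw [eo _ h3 h4]; exact hxi
    have hsum' : ∀ l, ∑ i ∈ range l, x' i
        = ∑ i ∈ range l, x i - (if j < l then δ else 0) + (if k < l then δ else 0) := by
      intro l
      induction l with
      | zero => simp
      | succ l ihl =>
        rw [Finset.sum_range_succ, Finset.sum_range_succ, ihl]
        by_cases h1 : l = j
        · subst h1
          rw [ej]
          simp [show ¬ k < l by omega, show ¬ k < l + 1 by omega]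
          ring
        · by_cases h2 : l = k
          · subst h2
            rw [ek]
            simp [hjk, show j < l + 1 by omega]
            try ring
          · rw [eo l h1 h2]
            have e1 : (j < l + 1) = (j < l) := by apply propext; omega
            have e2 : (k < l + 1) = (k < l) := by apply propext; omega
            simp only [e1, e2]; ring
    have hpart' : ∀ l ≤ n, ∑ i ∈ range l, y i ≤ ∑ i ∈ range l, x' i := by
      intro l hln
      rw [hsum']
      have hp := hpart l hln
      by_cases h1 : j < l
      · by_cases h2 : k < l
        · simp [h1, h2, hp]
        · simp only [h1, h2, if_true, if_false, add_zero]
          have g1 := Finset.sum_range_add_sum_Ico x (show j + 1 ≤ l from h1)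
          have g2 := Finset.sum_range_add_sum_Ico y (show j + 1 ≤ l from h1)
          have g3 : ∑ i ∈ Finset.Ico (j+1) l, x i = ∑ i ∈ Finset.Ico (j+1) l, y i := by
            apply Finset.sum_congr rfl
            intro i hi
            rw [Finset.mem_Ico] at hi
            exact hmid i (by omega) (by omega)
          rw [Finset.sum_range_succ] at g1 g2
          linarith
      · simp [h1, show ¬ k < l by omega, hp]
    have htot' : ∑ i ∈ range n, y i = ∑ i ∈ range n, x' i := by
      rw [hsum', htot]; simp [hjn, hkn]
    have hcard' : ((range n).filter (fun i => x' i ≠ y i)).card ≤ N := by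
      have hss : (range n).filter (fun i => x' i ≠ y i) ⊂ (range n).filter (fun i => x i ≠ y i) := by
        rw [Finset.ssubset_iff_of_subset]
        · rcases hδc with h | h
          · refine ⟨j, by simp [hjn, hjlt.ne'], ?_⟩
            simp [ej, h]
          · refine ⟨k, by simp [hkn, hklt.ne], ?_⟩
            simp [ek, h]
        · intro i hi
          simp only [Finset.mem_filter, Finset.mem_range] at hi ⊢
          refine ⟨hi.1, ?_⟩
          by_cases h1 : i = j
          · subst h1; exact hjlt.ne'
          · by_cases h2 : i = k
            · subst h2; exact hklt.ne
            · rw [← eo i h1 h2]; exact hi.2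
      have := Finset.card_lt_card hss
      omega
    obtain ⟨w, hw, hw1, hw2⟩ := pen_roots n hn lam hl x' hanti'
    obtain ⟨u', hu', hu1, hu2⟩ := pen_roots n hn lam hl x hx
    have m1 := ih x' hanti' hcard' hpart' htot' w v hw hv
    have m2 := transfer_step n hn lam hl x x' hx hanti' j k hjk hkn δ hδ0.le ej ek eo u' w
      hu' hu1 hu2 hw hw1 hw2
    intro f hf
    rw [rp_unique n u u' (by rw [← hu, hu']) f]
    exact (m1 f hf).trans (m2 f hf)

lemma exists_sorted (n : ℕ) (hn : 1 ≤ n) (x : ℕ → ℝ) :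
    ∃ z : ℕ → ℝ, Antitone z ∧ rp n z = rp n x := by
  set g : Fin n → ℝ := fun i => - x i with hg
  have hm := Tuple.monotone_sort g
  set σ := Tuple.sort g
  refine ⟨fun i => x (σ ⟨min i (n-1), by omega⟩), ?_, ?_⟩
  · intro a b hab
    have := hm (show (⟨min a (n-1), by omega⟩ : Fin n) ≤ ⟨min b (n-1), by omega⟩ by
      rw [Fin.mk_le_mk]; omega)
    simp only [hg, Function.comp] at this
    linarith
  · unfold rp
    rw [Finset.prod_range, Finset.prod_range, ← Equiv.prod_comp σ (fun i : Fin n => X - C (x i))]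
    apply Finset.prod_congr rfl
    intro i _
    have : (⟨min (i:ℕ) (n-1), by omega⟩ : Fin n) = i := by
      ext; simp only; omega
    simp only [this]

lemma convex_hinge (c : ℝ) : ConvexOn ℝ Set.univ (fun t : ℝ => max (t - c) 0) := by
  apply ConvexOn.sup
  · exact (convexOn_id convex_univ).sub (concaveOn_const c convex_univ)
  · exact convexOn_const 0 convex_univ

lemma pos_case (n : ℕ) (hn : 1 ≤ n) (lam : ℝ) (hl : 0 < lam) (x y : ℕ → ℝ)
    (hmaj : MajorizedOn n y x) :
    ∃ u v : ℕ → ℝ, pen n lam x = rp n u ∧ pen n lam y = rp n v ∧ MajorizedOn n v u := by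
  obtain ⟨a, ha, hax⟩ := exists_sorted n hn x
  obtain ⟨b, hb, hby⟩ := exists_sorted n hn y
  have hab : MajorizedOn n b a := by
    intro f hf
    rw [rp_unique n b y hby f, rp_unique n a x hax f]
    exact hmaj f hf
  have e1 : pen n lam x = pen n lam a := by unfold pen; rw [hax]
  have e2 : pen n lam y = pen n lam b := by unfold pen; rw [hby]
  obtain ⟨u, hu, _⟩ := pen_roots n hn lam hl a ha
  obtain ⟨v, hv, _⟩ := pen_roots n hn lam hl b hb
  refine ⟨u, v, by rw [e1, hu], by rw [e2, hv], ?_⟩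
  refine chain n hn lam hl b hb _ a ha le_rfl ?_ ?_ u v hu hv
  · intro k hk
    rcases Nat.eq_zero_or_pos k with h0 | h0
    · subst h0; simp
    have h := hab _ (convex_hinge (a (k-1)))
    have h1 : ∑ i ∈ range n, max (a i - a (k-1)) 0 = ∑ i ∈ range k, (a i - a (k-1)) := by
      rw [← Finset.sum_range_add_sum_Ico _ hk]
      have : ∑ i ∈ Finset.Ico k n, max (a i - a (k-1)) 0 = 0 := by
        apply Finset.sum_eq_zero
        intro i hi
        rw [Finset.mem_Ico] at hi
        have := ha (show k - 1 ≤ i by omega)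
        exact max_eq_right (by linarith)
      rw [this, add_zero]
      apply Finset.sum_congr rfl
      intro i hi
      have := ha (show i ≤ k - 1 by have := Finset.mem_range.1 hi; omega)
      exact max_eq_left (by linarith)
    have h2 : ∑ i ∈ range k, (b i - a (k-1)) ≤ ∑ i ∈ range n, max (b i - a (k-1)) 0 := by
      refine (Finset.sum_le_sum (fun i _ => le_max_left _ (0:ℝ))).trans ?_
      apply Finset.sum_le_sum_of_subset_of_nonneg
      · exact Finset.range_subset_range.2 hk
      · intro i _ _; exact le_max_right _ _
    simp only [h1] at h
    have h3 := h2.trans h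
    rw [Finset.sum_sub_distrib, Finset.sum_sub_distrib] at h3
    linarith
  · have h1 := hab id (convexOn_id convex_univ)
    have h2 := hab (fun t => -t) (concaveOn_id convex_univ).neg
    simp only [id, Finset.sum_neg_distrib] at h1 h2
    linarith

lemma rp_neg (n : ℕ) (x : ℕ → ℝ) :
    rp n (fun i => - x i) = (-1)^n * (rp n x).comp (-X) := by
  unfold rp
  rw [Polynomial.prod_comp]
  have : ((-1 : ℝ[X])^n) = ∏ i ∈ range n, (-1 : ℝ[X]) := by simp
  rw [this, ← Finset.prod_mul_distrib]
  apply Finset.prod_congr rfl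
  intro i _
  simp
  ring

lemma pen_neg (n : ℕ) (lam : ℝ) (x : ℕ → ℝ) :
    pen n (-lam) (fun i => - x i) = (-1)^n * (pen n lam x).comp (-X) := by
  unfold pen
  rw [rp_neg]
  have hd : derivative ((-1 : ℝ[X])^n * (rp n x).comp (-X))
      = - ((-1)^n * (derivative (rp n x)).comp (-X)) := by
    have : ((-1 : ℝ[X])^n) = C ((-1)^n) := by simp
    rw [this, derivative_C_mul, derivative_comp]
    simp
  rw [hd, sub_comp, mul_comp, C_comp, C_neg]
  ring

lemma pen_neg_rp (n : ℕ) (lam : ℝ) (x u : ℕ → ℝ)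
    (h : pen n (-lam) (fun i => - x i) = rp n u) : pen n lam x = rp n (fun i => - u i) := by
  have h1 := pen_neg n (-lam) (fun i => - x i)
  rw [h, ← rp_neg] at h1
  simpa using h1

lemma maj_neg (n : ℕ) (x y : ℕ → ℝ) (h : MajorizedOn n x y) :
    MajorizedOn n (fun i => - x i) (fun i => - y i) := by
  intro f hf
  refine h (fun t => f (-t)) ?_
  have := hf.comp_linearMap (-LinearMap.id : ℝ →ₗ[ℝ] ℝ)
  simpa [Function.comp_def] using this

/-- Theorem (main1): the pencil operation `P ↦ P - λP'` preserves the spectral order on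
monic hyperbolic polynomials of degree `n`. -/
theorem pencil_preserves_spectral_order
    (n : ℕ) (hn : 1 ≤ n) (x y : ℕ → ℝ)
    (P Q : Polynomial ℝ)
    (hP : P = ∏ i ∈ Finset.range n, (X - C (x i)))
    (hQ : Q = ∏ i ∈ Finset.range n, (X - C (y i)))
    (hmaj : MajorizedOn n y x) :
    ∀ lam : ℝ, ∃ u v : ℕ → ℝ,
      P - C lam * derivative P = ∏ i ∈ Finset.range n, (X - C (u i)) ∧
      Q - C lam * derivative Q = ∏ i ∈ Finset.range n, (X - C (v i)) ∧
      MajorizedOn n v u := by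
  intro lam
  subst hP hQ
  change ∃ u v : ℕ → ℝ, pen n lam x = rp n u ∧ pen n lam y = rp n v ∧ MajorizedOn n v u
  rcases lt_trichotomy lam 0 with h | h | h
  · obtain ⟨u, v, h1, h2, h3⟩ := pos_case n hn (-lam) (by linarith) _ _ (maj_neg n y x hmaj)
    exact ⟨_, _, pen_neg_rp n lam x u h1, pen_neg_rp n lam y v h2, maj_neg n v u h3⟩
  · subst h
    exact ⟨x, y, by simp [pen], by simp [pen], hmaj⟩
  · exact pos_case n hn lam h x y hmaj
end

section
/- Let m ≥ 1, p ≥ 0, n ≥ max(1, m−p), H(x) = ∏_{i=0}^{m−1}(x−i), and let T be the operator sending ∑_{k=0}^n a_k x^k to H(n+p)^{-1}∑_{k=0}^n H(k+p)a_k x^k. If P, Q are monic hyperbolic polynomials of degree n with the roots of Q majorized by the roots of P, then T[P] and T[Q] are monic hyperbolic of degree n and the roots of T[Q] are majorized by the roots of T[P]. -/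
open Polynomial Finset

/-- `Hval m j = ∏_{i<m} (j - i)`. -/
def Hval (m : ℕ) (j : ℕ) : ℝ := ∏ i ∈ Finset.range m, ((j : ℝ) - (i : ℝ))


theorem exists_support_fun (n : ℕ) (c x : ℕ → ℝ) (hc : Monotone c) (hx : Monotone x) :
    ∃ f : ℝ → ℝ, ConvexOn ℝ Set.univ f ∧
      ∀ i ≤ n, ∀ t, f (x i) + c i * (t - x i) ≤ f t := by
  refine ⟨fun t => c 0 * t + ∑ k ∈ Finset.range n, (c (k+1) - c k) * max (t - x (k+1)) 0, ?_, ?_⟩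
  · have h1 : ConvexOn ℝ Set.univ (fun t : ℝ => c 0 * t) := by
      refine ⟨convex_univ, fun a _ b _ s r _ _ _ => ?_⟩
      simp only [smul_eq_mul]; apply le_of_eq; ring
    have h2 : ∀ k, ConvexOn ℝ Set.univ
        (fun t : ℝ => (c (k+1) - c k) * max (t - x (k+1)) 0) := by
      intro k
      have h3 : ConvexOn ℝ Set.univ (fun t : ℝ => t - x (k+1)) := by
        refine ⟨convex_univ, fun a _ b _ s r _ _ hsr => ?_⟩
        simp only [smul_eq_mul]; apply le_of_eq
        linear_combination (x (k+1)) * hsr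
      have h4 := h3.sup (convexOn_const (0:ℝ) convex_univ)
      exact h4.smul (sub_nonneg.2 (hc (Nat.le_succ k)))
    have h5 : ConvexOn ℝ Set.univ
        (fun t : ℝ => ∑ k ∈ Finset.range n, (c (k+1) - c k) * max (t - x (k+1)) 0) := by
      induction n with
      | zero => simpa using convexOn_const (0:ℝ) convex_univ
      | succ n ih =>
        simp only [Finset.sum_range_succ]
        exact ih.add (h2 n)
    exact h1.add h5
  · intro i hi t
    have key : ∑ k ∈ Finset.range n, ((c (k+1) - c k) * max (x i - x (k+1)) 0
        + (if k < i then (c (k+1) - c k) else 0) * (t - x i))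
        ≤ ∑ k ∈ Finset.range n, (c (k+1) - c k) * max (t - x (k+1)) 0 := by
      apply Finset.sum_le_sum
      intro k _
      have h0 : 0 ≤ c (k+1) - c k := sub_nonneg.2 (hc (Nat.le_succ k))
      split_ifs with h
      · have : x (k+1) ≤ x i := hx h
        rw [max_eq_left (by linarith), ← mul_add]
        apply mul_le_mul_of_nonneg_left _ h0
        exact le_trans (by linarith) (le_max_left _ _)
      · have : x i ≤ x (k+1) := hx (by omega)
        rw [max_eq_right (by linarith)]
        simp only [mul_zero, zero_mul, add_zero]
        exact mul_nonneg h0 (le_max_right _ _)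
    rw [Finset.sum_add_distrib, ← Finset.sum_mul, ← Finset.sum_filter] at key
    have h6 : (Finset.range n).filter (fun k => k < i) = Finset.range i := by
      ext k; simp; omega
    rw [h6, Finset.sum_range_sub] at key
    simp only
    linarith

def MajF {ι : Type} [Fintype ι] (y x : ι → ℝ) : Prop :=
  ∀ f : ℝ → ℝ, ConvexOn ℝ Set.univ f → ∑ i, f (y i) ≤ ∑ i, f (x i)

theorem majF_linear {N : ℕ} (y x c : Fin (N+1) → ℝ) (h : MajF y x) :
    ∃ σ : Equiv.Perm (Fin (N+1)), ∑ i, c i * y i ≤ ∑ i, c i * x (σ i) := by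
  set s := Tuple.sort c
  set r := Tuple.sort x
  have hs : Monotone (c ∘ s) := Tuple.monotone_sort c
  have hr : Monotone (x ∘ r) := Tuple.monotone_sort x
  let e : ℕ → Fin (N+1) := fun k => ⟨min k N, by omega⟩
  have he : Monotone e := fun a b hab => by
    simp only [e, Fin.mk_le_mk]; omega
  have hei : ∀ i : Fin (N+1), e i = i := fun i => by
    ext; simp only [e]; omega
  obtain ⟨f, hf, hs'⟩ := exists_support_fun N (c ∘ s ∘ e) (x ∘ r ∘ e) (hs.comp he) (hr.comp he)
  refine ⟨s.symm.trans r, ?_⟩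
  rw [← Equiv.sum_comp s (fun i => c i * y i), ← Equiv.sum_comp s (fun i => c i * x _)]
  have h1 : ∑ i, (f (x (r i)) + c (s i) * (y (s i) - x (r i))) ≤ ∑ i, f (y (s i)) := by
    apply Finset.sum_le_sum
    intro i _
    have := hs' i (by omega) (y (s i))
    simpa [hei] using this
  have h2 := h f hf
  rw [Equiv.sum_comp s (fun i => f (y i)), Finset.sum_add_distrib,
    Equiv.sum_comp r (fun i => f (x i))] at h1
  simp only [mul_sub, Finset.sum_sub_distrib] at h1
  simp only [Equiv.trans_apply, Equiv.symm_apply_apply]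
  linarith

theorem majF_convexHull {N : ℕ} (y x : Fin (N+1) → ℝ) (h : MajF y x) :
    y ∈ convexHull ℝ (Set.range (fun σ : Equiv.Perm (Fin (N+1)) => x ∘ σ)) := by
  by_contra hy
  obtain ⟨g, u, h1, h2⟩ := geometric_hahn_banach_closed_point (convex_convexHull ℝ _)
    ((Set.finite_range (fun σ : Equiv.Perm (Fin (N+1)) => x ∘ σ)).isClosed_convexHull ℝ) hy
  have hg : ∀ z : Fin (N+1) → ℝ, g z = ∑ i, g (Pi.single i 1) * z i := by
    intro z
    conv_lhs => rw [pi_eq_sum_univ' z]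
    rw [map_sum]
    apply Finset.sum_congr rfl
    intro i _
    rw [map_smul, smul_eq_mul, mul_comm]
  obtain ⟨σ, hσ⟩ := majF_linear y x (fun i => g (Pi.single i 1)) h
  have h3 := h1 (x ∘ σ) (subset_convexHull ℝ _ ⟨σ, rfl⟩)
  rw [hg] at h2 h3
  simp only [Function.comp] at h3
  linarith

/-- compression of `diagonal x` to the orthogonal complement of the all-ones vector -/
noncomputable def projMat (N : ℕ) : Matrix (Fin (N+1)) (Fin (N+1)) ℝ :=
  1 - Matrix.of (fun _ _ => ((N:ℝ)+1)⁻¹)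

noncomputable def Amat {N : ℕ} (x : Fin (N+1) → ℝ) : Matrix (Fin (N+1)) (Fin (N+1)) ℝ :=
  projMat N * Matrix.diagonal x * projMat N

theorem projMat_sq (N : ℕ) : projMat N * projMat N = projMat N := by
  have h : (Matrix.of (fun _ _ => ((N:ℝ)+1)⁻¹) : Matrix (Fin (N+1)) (Fin (N+1)) ℝ)
    * Matrix.of (fun _ _ => ((N:ℝ)+1)⁻¹) = Matrix.of (fun _ _ => ((N:ℝ)+1)⁻¹) := by
    ext i j
    have : (N:ℝ)+1 ≠ 0 := by positivity
    simp [Matrix.mul_apply]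
    field_simp
  unfold projMat
  rw [sub_mul, mul_sub, one_mul, mul_sub, h]; simp

theorem projMat_herm (N : ℕ) : (projMat N).conjTranspose = projMat N := by
  ext i j
  simp [projMat, Matrix.one_apply, eq_comm]

theorem Amat_herm {N : ℕ} (x : Fin (N+1) → ℝ) : (Amat x).IsHermitian := by
  unfold Matrix.IsHermitian Amat
  rw [Matrix.conjTranspose_mul, Matrix.conjTranspose_mul, projMat_herm,
    Matrix.diagonal_conjTranspose, mul_assoc]
  simp

theorem Amat_charpoly {N : ℕ} (x : Fin (N+1) → ℝ) :
    C ((N:ℝ)+1) * (Amat x).charpoly = X * derivative (∏ i, (X - C (x i))) := by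
  have hN : (N:ℝ)+1 ≠ 0 := by positivity
  unfold Amat
  rw [Matrix.charpoly_mul_comm, ← mul_assoc, projMat_sq]
  apply Polynomial.eq_of_infinite_eval_eq
  apply Set.Infinite.mono (s := (Set.range x)ᶜ)
  · intro z hz
    have hz' : ∀ i, z - x i ≠ 0 := fun i h => hz ⟨i, by linarith⟩
    simp only [Set.mem_ofPred_eq, eval_mul, eval_C, eval_X]
    rw [Matrix.eval_charpoly]
    have h1 : Matrix.scalar (Fin (N+1)) z - projMat N * Matrix.diagonal x
        = Matrix.diagonal (fun i => z - x i) +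
          Matrix.replicateCol Unit (fun _ => ((N:ℝ)+1)⁻¹) * Matrix.replicateRow Unit x := by
      ext i j
      by_cases hij : i = j
      · subst hij; simp [projMat, Matrix.mul_apply, sub_mul, Matrix.one_apply, Matrix.diagonal_apply,
          Finset.sum_sub_distrib]; ring
      · simp [projMat, Matrix.mul_apply, sub_mul, Matrix.one_apply, Matrix.diagonal_apply,
          Finset.sum_sub_distrib, hij]
    have hdet : IsUnit (Matrix.diagonal (fun i => z - x i)).det := by
      rw [Matrix.det_diagonal, isUnit_iff_ne_zero]
      exact Finset.prod_ne_zero_iff.2 fun i _ => hz' i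
    have hinv : (Matrix.diagonal (fun i => z - x i))⁻¹ = Matrix.diagonal (fun i => (z - x i)⁻¹) := by
      apply Matrix.inv_eq_right_inv
      rw [Matrix.diagonal_mul_diagonal, ← Matrix.diagonal_one]
      congr 1; ext i; exact mul_inv_cancel₀ (hz' i)
    rw [h1, Matrix.det_add_replicateCol_mul_replicateRow hdet, hinv, Matrix.det_diagonal,
      Matrix.det_unique]
    have h2 : eval z (derivative (∏ i, (X - C (x i))))
        = (∏ i, (z - x i)) * ∑ i, (z - x i)⁻¹ := by
      rw [derivative_prod_finset]
      simp only [derivative_X_sub_C, mul_one, eval_finsetSum, eval_prod, eval_sub, eval_X, eval_C]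
      rw [Finset.mul_sum]
      apply Finset.sum_congr rfl
      intro i _
      rw [← Finset.prod_erase_mul _ _ (Finset.mem_univ i), mul_assoc, mul_inv_cancel₀ (hz' i),
        mul_one]
    rw [h2]
    have h3 : ((N:ℝ)+1) * (1 + ∑ i, x i * (z - x i)⁻¹ * ((N:ℝ)+1)⁻¹) = z * ∑ i, (z - x i)⁻¹ := by
      rw [← Finset.sum_mul, mul_add, mul_one, mul_comm _ ((N:ℝ)+1)⁻¹, mul_inv_cancel_left₀ hN]
      have : ((N:ℝ)+1) = ∑ i : Fin (N+1), (1:ℝ) := by simp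
      rw [this, ← Finset.sum_add_distrib, Finset.mul_sum]
      apply Finset.sum_congr rfl
      intro i _
      field_simp [hz' i]
      ring
    rw [Matrix.add_apply, Matrix.one_apply_eq, Matrix.mul_apply]
    simp only [Matrix.mul_diagonal, Matrix.replicateRow_apply, Matrix.replicateCol_apply]
    linear_combination (∏ i, (z - x i)) * h3
  · exact (Set.finite_range x).infinite_compl

/-- Peierls type inequality. -/
theorem peierls {N : ℕ} (B W : Matrix (Fin (N+1)) (Fin (N+1)) ℝ) (hB : B.IsHermitian)
    (hW : W ∈ Matrix.unitaryGroup (Fin (N+1)) ℝ) (f : ℝ → ℝ) (hf : ConvexOn ℝ Set.univ f) :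
    ∑ i, f ((star W * B * W) i i) ≤ ∑ i, f (hB.eigenvalues i) := by
  set U : Matrix (Fin (N+1)) (Fin (N+1)) ℝ := hB.eigenvectorUnitary.1 with hU
  have hUm : U ∈ Matrix.unitaryGroup (Fin (N+1)) ℝ := hB.eigenvectorUnitary.2
  have hsp : B = U * Matrix.diagonal hB.eigenvalues * star U := by
    have := hB.spectral_theorem
    rw [Unitary.conjStarAlgAut_apply] at this
    exact this
  set V := star W * U with hV
  have hVm : V ∈ Matrix.unitaryGroup (Fin (N+1)) ℝ := mul_mem (Unitary.star_mem hW) hUm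
  have hVV : star W * B * W = V * Matrix.diagonal hB.eigenvalues * star V := by
    conv_lhs => rw [hsp]
    simp only [hV, star_mul, star_star, mul_assoc]
  have hrow : ∀ i, ∑ k, V i k ^ 2 = 1 := by
    intro i
    have := congrFun (congrFun (Matrix.mem_unitaryGroup_iff.1 hVm) i) i
    simpa [Matrix.mul_apply, Matrix.star_apply, sq] using this
  have hcol : ∀ k, ∑ i, V i k ^ 2 = 1 := by
    intro i
    have := congrFun (congrFun (Matrix.mem_unitaryGroup_iff'.1 hVm) i) i
    simpa [Matrix.mul_apply, Matrix.star_apply, sq] using this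
  have hent : ∀ i, (star W * B * W) i i = ∑ k, V i k ^ 2 • hB.eigenvalues k := by
    intro i
    rw [hVV, Matrix.mul_apply]
    apply Finset.sum_congr rfl
    intro k _
    rw [Matrix.mul_diagonal]; simp [Matrix.star_apply]; ring
  calc ∑ i, f ((star W * B * W) i i) ≤ ∑ i, ∑ k, V i k ^ 2 • f (hB.eigenvalues k) := by
        apply Finset.sum_le_sum
        intro i _
        rw [hent]
        exact hf.map_sum_le (fun k _ => sq_nonneg _) (hrow i) (fun _ _ => Set.mem_univ _)
    _ = ∑ i, f (hB.eigenvalues i) := by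
        rw [Finset.sum_comm]
        apply Finset.sum_congr rfl
        intro k _
        rw [← Finset.sum_smul, hcol, one_smul]

theorem Amat_eig_perm {N : ℕ} (x : Fin (N+1) → ℝ) (σ : Equiv.Perm (Fin (N+1))) (f : ℝ → ℝ) :
    ∑ i, f ((Amat_herm (x ∘ σ)).eigenvalues i) = ∑ i, f ((Amat_herm x).eigenvalues i) := by
  have hN : (N:ℝ)+1 ≠ 0 := by positivity
  have h : (Amat (x ∘ σ)).charpoly = (Amat x).charpoly := by
    apply mul_left_cancel₀ (C_ne_zero.2 hN)
    rw [Amat_charpoly, Amat_charpoly]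
    congr 2
    exact Equiv.prod_comp σ (fun i => X - C (x i))
  have := (Matrix.IsHermitian.eigenvalues_eq_eigenvalues_iff (Amat_herm (x ∘ σ)) (Amat_herm x)).2 h
  rw [this]

theorem majF_eig {N : ℕ} (y x : Fin (N+1) → ℝ) (h : MajF y x) :
    MajF (Amat_herm y).eigenvalues (Amat_herm x).eigenvalues := by
  intro f hf
  set W : Matrix (Fin (N+1)) (Fin (N+1)) ℝ := (Amat_herm y).eigenvectorUnitary.1 with hW
  have hWm : W ∈ Matrix.unitaryGroup (Fin (N+1)) ℝ := (Amat_herm y).eigenvectorUnitary.2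
  have hlin : ∀ (i) (a b : Fin (N+1) → ℝ) (s t : ℝ), (star W * Amat (s • a + t • b) * W) i i
      = s * (star W * Amat a * W) i i + t * (star W * Amat b * W) i i := by
    intro i a b s t
    have : Amat (s • a + t • b) = s • Amat a + t • Amat b := by
      unfold Amat
      have : Matrix.diagonal (s • a + t • b) = s • Matrix.diagonal a + t • Matrix.diagonal b := by
        rw [← Matrix.diagonal_smul, ← Matrix.diagonal_smul, Matrix.diagonal_add]; rfl
      rw [this]; simp [mul_add, add_mul]
    rw [this]; simp [mul_add, add_mul]
  have hG : ConvexOn ℝ Set.univ (fun z : Fin (N+1) → ℝ => ∑ i, f ((star W * Amat z * W) i i)) := by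
    refine ⟨convex_univ, fun a _ b _ s t hs ht hst => ?_⟩
    simp only [hlin, Finset.smul_sum]
    rw [← Finset.sum_add_distrib]
    apply Finset.sum_le_sum
    intro i _
    exact hf.2 (Set.mem_univ _) (Set.mem_univ _) hs ht hst
  obtain ⟨_, ⟨σ, rfl⟩, hσ⟩ := hG.exists_ge_of_mem_convexHull (Set.subset_univ _)
    (majF_convexHull y x h)
  have h1 : ∀ i, (star W * Amat y * W) i i = (Amat_herm y).eigenvalues i := by
    intro i
    have h2 := (Amat_herm y).spectral_theorem
    rw [Unitary.conjStarAlgAut_apply] at h2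
    have h3 : Amat y = W * Matrix.diagonal (Amat_herm y).eigenvalues * star W := h2
    have hWW : star W * W = 1 := Matrix.mem_unitaryGroup_iff'.1 hWm
    have h4 : star W * Amat y * W = Matrix.diagonal (Amat_herm y).eigenvalues := by
      calc star W * Amat y * W
          = star W * (W * Matrix.diagonal (Amat_herm y).eigenvalues * star W) * W := by rw [← h3]
        _ = (star W * W) * Matrix.diagonal (Amat_herm y).eigenvalues * (star W * W) := by
            simp only [mul_assoc]
        _ = _ := by rw [hWW, one_mul, mul_one]
    rw [h4]; simp
  simp only [h1] at hσ
  refine hσ.trans ((peierls _ W (Amat_herm (x ∘ σ)) hWm f hf).trans ?_)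
  rw [Amat_eig_perm]

def MajM (s t : Multiset ℝ) : Prop :=
  ∀ f : ℝ → ℝ, ConvexOn ℝ Set.univ f → (s.map f).sum ≤ (t.map f).sum

theorem majM_add_left (r s t : Multiset ℝ) : MajM (r + s) (r + t) ↔ MajM s t := by
  simp [MajM]

theorem exists_fin_enum (n : ℕ) (s : Multiset ℝ) (h : s.card = n) :
    ∃ x : Fin n → ℝ, s = Finset.univ.val.map x := by
  subst h
  induction s using Quotient.inductionOn with
  | h l =>
    refine ⟨l.get, ?_⟩
    change (l : Multiset ℝ) = Multiset.map l.get (Finset.univ : Finset (Fin l.length)).val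
    rw [Fin.univ_val_map, List.ofFn_get]

theorem majM_fin {n : ℕ} (y x : Fin n → ℝ) :
    MajM (Finset.univ.val.map y) (Finset.univ.val.map x) ↔ MajF y x := by
  simp only [MajM, MajF, Finset.sum, Multiset.map_map, Function.comp_def]

theorem derivative_eig {N : ℕ} (P : ℝ[X]) (hP : P.Splits) (hd : P.natDegree = N + 1)
    (x : Fin (N+1) → ℝ) (hx : P.roots = Finset.univ.val.map x) :
    (derivative P).Splits ∧
      {0} + (derivative P).roots = Finset.univ.val.map (Amat_herm x).eigenvalues := by
  have hN : (N:ℝ)+1 ≠ 0 := by positivity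
  have hP0 : P ≠ 0 := by rintro rfl; simp at hd
  have hl : P.leadingCoeff ≠ 0 := leadingCoeff_ne_zero.2 hP0
  have h1 : P = C P.leadingCoeff * ∏ i, (X - C (x i)) := by
    conv_lhs => rw [hP.eq_prod_roots, hx, Multiset.map_map]
    rfl
  have h2 : X * derivative P = C (P.leadingCoeff * ((N:ℝ)+1)) * (Amat x).charpoly := by
    rw [C_mul, mul_assoc, Amat_charpoly]
    conv_lhs => rw [h1, derivative_C_mul]
    ring
  have hc : (Amat x).charpoly ≠ 0 := (Matrix.charpoly_monic _).ne_zero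
  have h3 : X * derivative P ≠ 0 := by
    rw [h2]; exact mul_ne_zero (C_ne_zero.2 (mul_ne_zero hl hN)) hc
  constructor
  · rw [← splits_X_mul, h2]
    exact (Amat_herm x).splits_charpoly.C_mul _
  · have h4 := congrArg roots h2
    rw [roots_mul h3, roots_X, roots_C_mul _ (mul_ne_zero hl hN),
      (Amat_herm x).roots_charpoly_eq_eigenvalues] at h4
    exact h4

theorem maj_derivative (P Q : ℝ[X]) (hP : P.Splits) (hQ : Q.Splits)
    (hd : P.natDegree = Q.natDegree) (h : MajM Q.roots P.roots) :
    (derivative P).Splits ∧ (derivative Q).Splits ∧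
      (derivative P).natDegree = (derivative Q).natDegree ∧
      MajM (derivative Q).roots (derivative P).roots := by
  rcases hn : P.natDegree with _ | N
  · rw [derivative_of_natDegree_zero hn, derivative_of_natDegree_zero (hd ▸ hn)]
    exact ⟨Splits.zero, Splits.zero, rfl, fun f _ => le_rfl⟩
  · obtain ⟨x, hx⟩ := exists_fin_enum (N+1) P.roots (by rw [← hP.natDegree_eq_card_roots, hn])
    obtain ⟨y, hy⟩ := exists_fin_enum (N+1) Q.roots (by rw [← hQ.natDegree_eq_card_roots, ← hd, hn])
    obtain ⟨h1, h2⟩ := derivative_eig P hP hn x hx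
    obtain ⟨h3, h4⟩ := derivative_eig Q hQ (hd ▸ hn) y hy
    refine ⟨h1, h3, ?_, ?_⟩
    · have e1 := congrArg Multiset.card h2
      have e2 := congrArg Multiset.card h4
      rw [h1.natDegree_eq_card_roots, h3.natDegree_eq_card_roots]
      simp only [Multiset.card_add, Multiset.card_map] at e1 e2
      omega
    · rw [← majM_add_left {0}, h2, h4, majM_fin]
      rw [hx, hy, majM_fin] at h
      exact majF_eig y x h

theorem maj_iterate (m : ℕ) : ∀ (P Q : ℝ[X]) (_ : P.Splits) (_ : Q.Splits)
    (_ : P.natDegree = Q.natDegree) (_ : MajM Q.roots P.roots),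
    (derivative^[m] P).Splits ∧ (derivative^[m] Q).Splits ∧
      MajM (derivative^[m] Q).roots (derivative^[m] P).roots := by
  induction m with
  | zero => intro P Q h1 h2 _ h4; exact ⟨h1, h2, h4⟩
  | succ m ih =>
    intro P Q h1 h2 h3 h4
    obtain ⟨a, b, c, d⟩ := maj_derivative P Q h1 h2 h3 h4
    exact ih _ _ a b c d

theorem Hval_eq (m j : ℕ) : Hval m j = (j.descFactorial m : ℝ) := by
  induction m with
  | zero => simp [Hval]
  | succ m ih =>
    rw [Nat.descFactorial_succ, Hval, Finset.prod_range_succ]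
    change Hval m j * _ = _
    rw [ih]
    by_cases h : m ≤ j
    · push_cast [h]; ring
    · rw [Nat.descFactorial_eq_zero_iff_lt.2 (by omega)]; simp

theorem mult_coeff (m p n : ℕ) (P : ℝ[X]) (hd : P.natDegree ≤ n) (k : ℕ) :
    (∑ k ∈ Finset.range (n + 1), C (Hval m (k + p)) * C (P.coeff k) * X ^ k).coeff k
      = Hval m (k + p) * P.coeff k := by
  simp only [← C_mul, finsetSum_coeff, coeff_C_mul_X_pow]
  rw [Finset.sum_ite_eq]
  split_ifs with h
  · rfl
  · rw [coeff_eq_zero_of_natDegree_lt (n := k) (by simp at h; omega), mul_zero]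

theorem mult_identity (m p n : ℕ) (P : ℝ[X]) (hd : P.natDegree ≤ n) :
    X ^ m * derivative^[m] (X ^ p * P) =
      X ^ p * ∑ k ∈ Finset.range (n + 1), C (Hval m (k + p)) * C (P.coeff k) * X ^ k := by
  ext j
  rw [coeff_X_pow_mul', coeff_X_pow_mul', mult_coeff _ _ _ _ hd, coeff_iterate_derivative,
    coeff_X_pow_mul', Hval_eq]
  by_cases h1 : m ≤ j
  · rw [if_pos h1, Nat.sub_add_cancel h1]
    split_ifs with h2
    · rw [Nat.sub_add_cancel h2, nsmul_eq_mul]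
    · simp
  · rw [if_neg h1]
    split_ifs with h2
    · rw [Nat.sub_add_cancel h2, Nat.descFactorial_eq_zero_iff_lt.2 (by omega)]; simp
    · rfl

theorem T_facts (m p n : ℕ) (hmn : m ≤ n + p) (P TP : ℝ[X]) (hPm : P.Monic)
    (hd : P.natDegree = n)
    (hTP : TP = C (Hval m (n + p))⁻¹ *
      ∑ k ∈ Finset.range (n + 1), C (Hval m (k + p)) * C (P.coeff k) * X ^ k)
    (hs : (derivative^[m] (X ^ p * P)).Splits) :
    TP = (TP.roots.map (fun a => X - C a)).prod ∧ TP.roots.card = n ∧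
    m • {0} + (derivative^[m] (X ^ p * P)).roots = p • {0} + TP.roots := by
  have hH : Hval m (n + p) ≠ 0 := by
    rw [Hval_eq, Nat.cast_ne_zero]
    intro h
    rw [Nat.descFactorial_eq_zero_iff_lt] at h
    omega
  have hcoeff : ∀ k, TP.coeff k = (Hval m (n + p))⁻¹ * (Hval m (k + p) * P.coeff k) := by
    intro k; rw [hTP, coeff_C_mul, mult_coeff _ _ _ _ hd.le]
  have hle : TP.natDegree ≤ n := by
    rw [natDegree_le_iff_coeff_eq_zero]
    intro k hk
    rw [hcoeff, coeff_eq_zero_of_natDegree_lt (by omega)]; simp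
  have hcn : TP.coeff n = 1 := by
    have : P.coeff n = 1 := by rw [← hd]; exact hPm
    rw [hcoeff, this, mul_one, inv_mul_cancel₀ hH]
  have hm : TP.Monic := monic_of_natDegree_le_of_coeff_eq_one n hle hcn
  have hdeg : TP.natDegree = n := natDegree_eq_of_le_of_coeff_ne_zero hle (by rw [hcn]; exact one_ne_zero)
  have hid : X ^ m * derivative^[m] (X ^ p * P) = X ^ p * (C (Hval m (n + p)) * TP) := by
    rw [mult_identity m p n P hd.le, hTP, ← mul_assoc (C _) (C _), ← C_mul, mul_inv_cancel₀ hH]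
    simp
  have hne : X ^ p * (C (Hval m (n + p)) * TP) ≠ 0 :=
    mul_ne_zero (pow_ne_zero _ X_ne_zero) (mul_ne_zero (C_ne_zero.2 hH) hm.ne_zero)
  have hsp : TP.Splits := by
    apply ((Splits.X_pow m).mul hs).of_dvd (hid ▸ hne)
    rw [hid, ← mul_assoc]; exact dvd_mul_left _ _
  refine ⟨hsp.eq_prod_roots_of_monic hm, by rw [← hsp.natDegree_eq_card_roots, hdeg], ?_⟩
  have := congrArg roots hid
  rw [roots_mul hne, roots_mul (hid ▸ hne), roots_X_pow, roots_X_pow, roots_C_mul _ hH] at this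
  exact this

theorem exists_nat_enum (n : ℕ) (s : Multiset ℝ) (h : s.card = n) :
    ∃ u : ℕ → ℝ, s = (Finset.range n).val.map u := by
  obtain ⟨x, rfl⟩ := exists_fin_enum n s h
  refine ⟨fun k => if hk : k < n then x ⟨k, hk⟩ else 0, ?_⟩
  simp only [Fin.univ_val_map, Finset.range_val, Multiset.range, Multiset.map_coe]
  congr 1
  apply List.ext_getElem
  · simp
  · intro i h1 h2
    simp at h1
    simp [h1]

theorem majM_range (n : ℕ) (y x : ℕ → ℝ) :
    MajM ((Finset.range n).val.map y) ((Finset.range n).val.map x) ↔ MajorizedOn n y x := by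
  simp [MajM, MajorizedOn, Finset.sum]

theorem prod_facts (n : ℕ) (x : ℕ → ℝ) :
    (∏ i ∈ Finset.range n, (X - C (x i))).Monic ∧
    (∏ i ∈ Finset.range n, (X - C (x i))).natDegree = n ∧
    (∏ i ∈ Finset.range n, (X - C (x i))).Splits ∧
    (∏ i ∈ Finset.range n, (X - C (x i))).roots = (Finset.range n).val.map x := by
  refine ⟨monic_prod_of_monic _ _ fun i _ => monic_X_sub_C _, ?_,
    Splits.prod fun i _ => Splits.X_sub_C _, ?_⟩
  · rw [natDegree_prod_of_monic _ _ fun i _ => monic_X_sub_C _]; simp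
  · have := roots_multiset_prod_X_sub_C ((Finset.range n).val.map x)
    rw [Multiset.map_map] at this
    exact this

/-- The normalized truncation of the multiplier sequence `{H(k+p)}` preserves monic
hyperbolic polynomials of degree `n` and the spectral order of their roots. -/
theorem truncated_multiplier_preserves_spectral_order
    (m p n : ℕ) (hm : 1 ≤ m) (hn1 : 1 ≤ n) (hn2 : m - p ≤ n)
    (x y : ℕ → ℝ) (P Q TP TQ : Polynomial ℝ)
    (hP : P = ∏ i ∈ Finset.range n, (X - C (x i)))
    (hQ : Q = ∏ i ∈ Finset.range n, (X - C (y i)))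
    (hTP : TP = C (Hval m (n + p))⁻¹ *
      ∑ k ∈ Finset.range (n + 1), C (Hval m (k + p)) * C (P.coeff k) * X ^ k)
    (hTQ : TQ = C (Hval m (n + p))⁻¹ *
      ∑ k ∈ Finset.range (n + 1), C (Hval m (k + p)) * C (Q.coeff k) * X ^ k)
    (hmaj : MajorizedOn n y x) :
    ∃ u v : ℕ → ℝ,
      TP = ∏ i ∈ Finset.range n, (X - C (u i)) ∧
      TQ = ∏ i ∈ Finset.range n, (X - C (v i)) ∧
      MajorizedOn n v u := by
  obtain ⟨a1, a2, a3, a4⟩ := prod_facts n x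
  obtain ⟨b1, b2, b3, b4⟩ := prod_facts n y
  rw [← hP] at a1 a2 a3 a4
  rw [← hQ] at b1 b2 b3 b4
  have hX : ∀ R : ℝ[X], R.Monic → (X ^ p * R).natDegree = p + R.natDegree ∧
      (X ^ p * R).roots = p • {0} + R.roots := by
    intro R hR
    refine ⟨?_, ?_⟩
    · rw [(monic_X_pow p).natDegree_mul hR, natDegree_X_pow]
    · rw [roots_mul (mul_ne_zero (pow_ne_zero _ X_ne_zero) hR.ne_zero), roots_X_pow]
  obtain ⟨c1, c2, c3⟩ := maj_iterate m (X ^ p * P) (X ^ p * Q) ((Splits.X_pow p).mul a3)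
    ((Splits.X_pow p).mul b3) (by rw [(hX P a1).1, (hX Q b1).1, a2, b2])
    (by rw [(hX P a1).2, (hX Q b1).2, majM_add_left, a4, b4, majM_range]; exact hmaj)
  obtain ⟨d1, d2, d3⟩ := T_facts m p n (by omega) P TP a1 a2 hTP c1
  obtain ⟨e1, e2, e3⟩ := T_facts m p n (by omega) Q TQ b1 b2 hTQ c2
  rw [← majM_add_left (m • {0}), d3, e3, majM_add_left] at c3
  obtain ⟨u, hu⟩ := exists_nat_enum n _ d2
  obtain ⟨v, hv⟩ := exists_nat_enum n _ e2
  refine ⟨u, v, ?_, ?_, ?_⟩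
  · rw [hu, Multiset.map_map] at d1; exact d1
  · rw [hv, Multiset.map_map] at e1; exact e1
  · rw [hu, hv, majM_range] at c3; exact c3
end

section
/- Let n ≥ 2 and let P(x) = ∏_{i=1}^n (x − x_i) with x_1 < … < x_n be strictly hyperbolic, fix i ∈ {1,…,n−1} and σ ∈ (0, (x_{i+1}−x_i)/2), and let Q = the contraction of P replacing x_i, x_{i+1} by x_i+σ, x_{i+1}−σ. Then for every λ ∈ ℝ the roots of Q − λQ′ are majorized by the roots of P − λP′. -/
open Polynomial Finset

theorem ivt_aux (q : ℝ[X]) (a b : ℝ) (hab : a < b) (h : q.eval a * q.eval b < 0) :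
    ∃ t, a < t ∧ t < b ∧ q.eval t = 0 := by
  have hc : ContinuousOn (fun t => q.eval t) (Set.Icc a b) := q.continuous.continuousOn
  rcases mul_neg_iff.1 h with ⟨h1, h2⟩ | ⟨h1, h2⟩
  · obtain ⟨t, ht, h0⟩ := intermediate_value_Ioo' hab.le hc ⟨h2, h1⟩
    exact ⟨t, ht.1, ht.2, h0⟩
  · obtain ⟨t, ht, h0⟩ := intermediate_value_Ioo hab.le hc ⟨h1, h2⟩
    exact ⟨t, ht.1, ht.2, h0⟩

theorem deriv_sign (s : Finset ℕ) (y : ℕ → ℝ) (j : ℕ) (hj : j ∈ s) (t : ℝ) (ht : t ≠ y j)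
    (h : ∀ k ∈ s, k ≠ j → 0 < (y j - y k) * (t - y k)) :
    0 < (t - y j) * ((derivative (∏ k ∈ s, (X - C (y k)))).eval (y j)
      * (∏ k ∈ s, (X - C (y k))).eval t) := by
  rw [← Finset.mul_prod_erase s _ hj]
  simp only [derivative_mul, eval_add, eval_mul, derivative_sub, derivative_X, derivative_C,
    eval_sub, eval_X, eval_C, eval_one, sub_zero, sub_self, zero_mul, add_zero, one_mul, eval_prod]
  have h1 : 0 < ∏ k ∈ s.erase j, ((y j - y k) * (t - y k)) :=
    Finset.prod_pos fun k hk => h k (Finset.mem_of_mem_erase hk) (Finset.ne_of_mem_erase hk)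
  rw [Finset.prod_mul_distrib] at h1
  have h2 : 0 < (t - y j) * (t - y j) := mul_self_pos.2 (sub_ne_zero.2 ht)
  nlinarith [mul_pos h1 h2]

/-- strict monotonicity on the range -/
def SIncr (n : ℕ) (x : ℕ → ℝ) : Prop := ∀ j k, j < k → k < n → x j < x k

theorem sIncr_of_succ {n : ℕ} {x : ℕ → ℝ} (hx : ∀ j, j + 1 < n → x j < x (j + 1)) :
    SIncr n x := by
  intro j k hjk
  induction k, hjk using Nat.le_induction with
  | base => exact fun h => hx j h
  | succ m hm ih => exact fun h => (ih (by omega)).trans (hx m h)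

theorem sign_right {n : ℕ} {y : ℕ → ℝ} (hy : SIncr n y) {j : ℕ} (hj : j < n) {t : ℝ}
    (h1 : y j < t) (h2 : j + 1 < n → t < y (j + 1)) :
    0 < (derivative (∏ k ∈ range n, (X - C (y k)))).eval (y j)
      * (∏ k ∈ range n, (X - C (y k))).eval t := by
  have := deriv_sign (range n) y j (by simpa using hj) t h1.ne' ?_
  · exact (mul_pos_iff_of_pos_left (sub_pos.2 h1)).1 this
  · intro k hk hkj
    have hk := Finset.mem_range.1 hk
    rcases lt_or_gt_of_ne hkj with h | h
    · have := hy k j h hj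
      exact mul_pos (by linarith) (by linarith)
    · have h3 := h2 (by omega)
      have h4 := hy j k h hk
      have h5 : y (j + 1) ≤ y k := by
        rcases (show j + 1 = k ∨ j + 1 < k by omega) with h | h
        · rw [h]
        · exact (hy _ _ h hk).le
      exact mul_pos_of_neg_of_neg (by linarith) (by linarith)

theorem sign_left {n : ℕ} {y : ℕ → ℝ} (hy : SIncr n y) {j : ℕ} (hj : j + 1 < n) {t : ℝ}
    (h1 : y j < t) (h2 : t < y (j + 1)) :
    (derivative (∏ k ∈ range n, (X - C (y k)))).eval (y (j + 1))
      * (∏ k ∈ range n, (X - C (y k))).eval t < 0 := by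
  have := deriv_sign (range n) y (j + 1) (by simpa using hj) t h2.ne ?_
  · nlinarith
  · intro k hk hkj
    have hk := Finset.mem_range.1 hk
    rcases lt_or_gt_of_ne hkj with h | h
    · have h3 := hy k (j + 1) h hj
      have h5 : y k ≤ y j := by
        rcases (show k = j ∨ k < j by omega) with h | h
        · rw [h]
        · exact (hy _ _ h (by omega)).le
      exact mul_pos (by linarith) (by linarith)
    · have h4 := hy _ k h hk
      exact mul_pos_of_neg_of_neg (by linarith) (by linarith)

theorem eval_pencil_root (n : ℕ) (y : ℕ → ℝ) (lam : ℝ) (j : ℕ) (hj : j < n) :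
    (∏ k ∈ range n, (X - C (y k)) - C lam * derivative (∏ k ∈ range n, (X - C (y k)))).eval (y j)
      = - lam * (derivative (∏ k ∈ range n, (X - C (y k)))).eval (y j) := by
  have : (∏ k ∈ range n, (X - C (y k))).eval (y j) = 0 := by
    rw [eval_prod]
    exact Finset.prod_eq_zero (Finset.mem_range.2 hj) (by simp)
  rw [eval_sub, this, eval_mul, eval_C]; ring

theorem pencil_mid {n : ℕ} {y : ℕ → ℝ} (hy : SIncr n y) {lam : ℝ} (hl : lam ≠ 0) {j : ℕ}
    (hj : j + 1 < n) : ∃ t, y j < t ∧ t < y (j + 1) ∧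
    (∏ k ∈ range n, (X - C (y k))
      - C lam * derivative (∏ k ∈ range n, (X - C (y k)))).eval t = 0 := by
  have h := hy j (j + 1) (by omega) hj
  apply ivt_aux _ _ _ h
  rw [eval_pencil_root n y lam j (by omega), eval_pencil_root n y lam (j + 1) hj]
  have h1 := sign_right hy (j := j) (by omega) (t := (y j + y (j + 1)) / 2) (by linarith)
    (fun _ => by linarith)
  have h2 := sign_left hy hj (t := (y j + y (j + 1)) / 2) (by linarith) (by linarith)
  generalize (derivative (∏ k ∈ range n, (X - C (y k)))).eval (y j) = A at *
  generalize (derivative (∏ k ∈ range n, (X - C (y k)))).eval (y (j + 1)) = B at *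
  generalize (∏ k ∈ range n, (X - C (y k))).eval ((y j + y (j + 1)) / 2) = T at *
  have h3 : (A * B) * (T * T) < 0 := by nlinarith [mul_neg_of_pos_of_neg h1 h2]
  have h4 : A * B < 0 := by
    by_contra hc
    push Not at hc
    nlinarith [mul_nonneg hc (mul_self_nonneg T)]
  have : 0 < lam * lam := mul_self_pos.2 hl
  nlinarith

theorem pencil_deg (n : ℕ) (hn : 0 < n) (y : ℕ → ℝ) (lam : ℝ) :
    (∏ k ∈ range n, (X - C (y k))
      - C lam * derivative (∏ k ∈ range n, (X - C (y k)))).Monic ∧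
    (∏ k ∈ range n, (X - C (y k))
      - C lam * derivative (∏ k ∈ range n, (X - C (y k)))).natDegree = n := by
  have hm : (∏ k ∈ range n, (X - C (y k))).Monic := monic_prod_X_sub_C _ _
  have hd : (∏ k ∈ range n, (X - C (y k))).natDegree = n := by simp
  have hlt : (C lam * derivative (∏ k ∈ range n, (X - C (y k)))).natDegree
      < (∏ k ∈ range n, (X - C (y k))).natDegree :=
    lt_of_le_of_lt (natDegree_C_mul_le _ _) (natDegree_derivative_lt (by omega))
  exact ⟨hm.sub_of_left (degree_lt_degree hlt),
    by rw [natDegree_sub_eq_left_of_natDegree_lt hlt, hd]⟩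

theorem pencil_eq {n : ℕ} (hn : 0 < n) (y v : ℕ → ℝ) (lam : ℝ) (hv : SIncr n v)
    (h0 : ∀ j < n, (∏ k ∈ range n, (X - C (y k))
      - C lam * derivative (∏ k ∈ range n, (X - C (y k)))).eval (v j) = 0) :
    ∏ k ∈ range n, (X - C (y k)) - C lam * derivative (∏ k ∈ range n, (X - C (y k)))
      = ∏ k ∈ range n, (X - C (v k)) := by
  obtain ⟨hm, hd⟩ := pencil_deg n hn y lam
  have hm2 : (∏ k ∈ range n, (X - C (v k))).Monic := monic_prod_X_sub_C _ _
  have hd2 : (∏ k ∈ range n, (X - C (v k))).natDegree = n := by simp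
  apply eq_of_degree_sub_lt_of_eval_index_eq (range n) (v := v)
  · intro a ha b hb hab
    simp only [Finset.coe_range, Set.mem_Iio] at ha hb
    rcases lt_trichotomy a b with h | h | h
    · exact absurd hab (hv a b h hb).ne
    · exact h
    · exact absurd hab (hv b a h ha).ne'
  · have := degree_sub_lt_left (p := ∏ k ∈ range n, (X - C (y k)) - C lam * derivative (∏ k ∈ range n, (X - C (y k)))) (q := ∏ k ∈ range n, (X - C (v k)))
      (by rw [degree_eq_natDegree hm.ne_zero, degree_eq_natDegree hm2.ne_zero, hd, hd2])
      hm.ne_zero (by rw [hm.leadingCoeff, hm2.leadingCoeff])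
    rw [degree_eq_natDegree hm.ne_zero, hd] at this
    rwa [Finset.card_range]
  · intro j hj
    rw [h0 j (Finset.mem_range.1 hj), eval_prod, Finset.prod_eq_zero hj (by simp)]

theorem pencil_last {n : ℕ} {y : ℕ → ℝ} (hy : SIncr n y) {lam : ℝ} (hl : 0 < lam) {j : ℕ}
    (hj : j + 1 = n) : ∃ t, y j < t ∧
    (∏ k ∈ range n, (X - C (y k))
      - C lam * derivative (∏ k ∈ range n, (X - C (y k)))).eval t = 0 := by
  obtain ⟨hm, hd⟩ := pencil_deg n (by omega) y lam
  have ht := tendsto_atTop_of_leadingCoeff_nonneg (∏ k ∈ range n, (X - C (y k))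
      - C lam * derivative (∏ k ∈ range n, (X - C (y k))))
      (natDegree_pos_iff_degree_pos.1 (by omega)) (by rw [hm.leadingCoeff]; norm_num)
  obtain ⟨s, hs, hs2⟩ := ((ht.eventually_gt_atTop 0).and (Filter.eventually_gt_atTop (y j))).exists
  have h1 := sign_right hy (j := j) (by omega) hs2 (fun h => by omega)
  have h2 : 0 < (∏ k ∈ range n, (X - C (y k))).eval s := by
    rw [eval_prod]
    refine Finset.prod_pos fun k hk => ?_
    have hk := Finset.mem_range.1 hk
    simp only [eval_sub, eval_X, eval_C]
    rcases (show k = j ∨ k < j by omega) with h | h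
    · rw [h]; linarith
    · have := hy k j h (by omega)
      linarith
  have h3 := (mul_pos_iff_of_pos_right h2).1 h1
  obtain ⟨t, h4, -, h5⟩ := ivt_aux (∏ k ∈ range n, (X - C (y k))
      - C lam * derivative (∏ k ∈ range n, (X - C (y k)))) (y j) s hs2 (by
      rw [eval_pencil_root n y lam j (by omega)]
      have := mul_pos hl h3
      nlinarith [mul_pos this hs])
  exact ⟨t, h4, h5⟩

theorem sum_roots {n : ℕ} (hn : 0 < n) (y v : ℕ → ℝ) (lam : ℝ)
    (h : ∏ k ∈ range n, (X - C (y k)) - C lam * derivative (∏ k ∈ range n, (X - C (y k)))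
      = ∏ k ∈ range n, (X - C (v k))) :
    ∑ k ∈ range n, v k = ∑ k ∈ range n, y k + lam * n := by
  have h1 := congrArg (fun p => coeff p (n - 1)) h
  have e1 := prod_X_sub_C_coeff_card_pred (range n) y (by simpa using hn)
  have e2 := prod_X_sub_C_coeff_card_pred (range n) v (by simpa using hn)
  have e3 : (∏ k ∈ range n, (X - C (y k))).coeff n = 1 := by
    have hm : (∏ k ∈ range n, (X - C (y k))).Monic := monic_prod_X_sub_C _ _
    have hd : (∏ k ∈ range n, (X - C (y k))).natDegree = n := by simp
    have := hm.coeff_natDegree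
    rwa [hd] at this
  rw [Finset.card_range] at e1 e2
  simp only [coeff_sub, coeff_C_mul, coeff_derivative] at h1
  rw [e1, e2, Nat.sub_add_cancel hn, e3, Nat.cast_sub hn] at h1
  push_cast at h1
  linarith

theorem majorize_aux (n i : ℕ) (u v : ℕ → ℝ) (hi : i < n) (hv : SIncr n v)
    (hs : ∑ k ∈ range n, v k = ∑ k ∈ range n, u k)
    (h1 : ∀ j < i, u j ≤ v j) (h2 : ∀ j < n, i < j → v j ≤ u j) : MajorizedOn n v u := by
  intro f hf
  let s : ℝ → ℝ := fun x => derivWithin f (Set.Ioi x) x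
  have hmono : ∀ a b, a ≤ b → s a ≤ s b := fun a b hab =>
    hf.monotoneOn_rightDeriv (by simp) (by simp) hab
  have hsub : ∀ a b, s a * (b - a) ≤ f b - f a := by
    intro a b
    rcases lt_trichotomy a b with h | h | h
    · have := hf.rightDeriv_le_slope_of_mem_interior (x := a) (y := b) (by simp) (by simp) h
      rw [slope_def_field, le_div_iff₀ (sub_pos.2 h)] at this
      exact this
    · subst h; simp
    · have h3 := hf.leftDeriv_le_rightDeriv_of_mem_interior (x := a) (by simp)
      have := hf.slope_le_leftDeriv_of_mem_interior (x := b) (y := a) (by simp) (by simp) h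
      have := this.trans h3
      rw [slope_def_field, div_le_iff₀ (sub_pos.2 h)] at this
      change f a - f b ≤ s a * (a - b) at this
      linarith
  have key : ∀ j ∈ range n, s (v i) * (u j - v j) ≤ f (u j) - f (v j) := by
    intro j hj
    have hj := Finset.mem_range.1 hj
    refine le_trans ?_ (hsub (v j) (u j))
    rcases lt_trichotomy j i with h | h | h
    · have := hmono _ _ (hv j i h hi).le
      nlinarith [h1 j h]
    · rw [h]
    · have := hmono _ _ (hv i j h hj).le
      nlinarith [h2 j hj h]
  have := Finset.sum_le_sum key
  rw [← Finset.mul_sum, Finset.sum_sub_distrib, Finset.sum_sub_distrib, hs] at this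
  linarith

theorem key_identity (R : ℝ[X]) (a b al be lam t : ℝ) (hab : al + be = a + b)
    (P Q : ℝ[X]) (hP : P = (X - C a) * ((X - C b) * R)) (hQ : Q = (X - C al) * ((X - C be) * R))
    (h0 : (P - C lam * derivative P).eval t = 0) :
    ((t - a) * (t - b)) * ((Q - C lam * derivative Q).eval t * Q.eval t)
      = lam * (al * be - a * b) * (2 * t - a - b) * ((t - al) * (t - be)) * (R.eval t) ^ 2 := by
  subst hP hQ
  simp only [eval_sub, eval_mul, derivative_mul, eval_add, derivative_sub, derivative_X,
    derivative_C, eval_X, eval_C, eval_one, sub_zero, one_mul] at h0 ⊢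
  have : be = a + b - al := by linarith
  subst this
  linear_combination ((t - al) * (t - (a + b - al))) * ((t - al) * ((t - (a + b - al)) * R.eval t)) * h0

theorem pos_case_s17 (n : ℕ) (x y : ℕ → ℝ) (i : ℕ) (hi : i + 1 < n)
    (hx : SIncr n x) (hy : SIncr n y) (σ : ℝ) (hσ : 0 < σ)
    (hi1 : y i = x i + σ) (hi2 : y (i + 1) = x (i + 1) - σ)
    (hyo : ∀ j < n, j ≠ i → j ≠ i + 1 → y j = x j) (lam : ℝ) (hl : 0 < lam) :
    ∃ u v : ℕ → ℝ,
      ∏ k ∈ range n, (X - C (x k)) - C lam * derivative (∏ k ∈ range n, (X - C (x k)))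
        = ∏ j ∈ range n, (X - C (u j)) ∧
      ∏ k ∈ range n, (X - C (y k)) - C lam * derivative (∏ k ∈ range n, (X - C (y k)))
        = ∏ j ∈ range n, (X - C (v j)) ∧
      MajorizedOn n v u := by
  have hu : ∀ j, ∃ t, j < n → (x j < t ∧ (j + 1 < n → t < x (j + 1)) ∧
      (∏ k ∈ range n, (X - C (x k))
      - C lam * derivative (∏ k ∈ range n, (X - C (x k)))).eval t = 0) := by
    intro j
    by_cases hj : j + 1 < n
    · obtain ⟨t, h1, h2, h3⟩ := pencil_mid hx hl.ne' hj
      exact ⟨t, fun _ => ⟨h1, fun _ => h2, h3⟩⟩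
    · by_cases hj2 : j < n
      · obtain ⟨t, h1, h3⟩ := pencil_last hx hl (show j + 1 = n by omega)
        exact ⟨t, fun _ => ⟨h1, fun h => absurd h hj, h3⟩⟩
      · exact ⟨0, fun h => absurd h hj2⟩
  choose u hu using hu
  have hxy := hy i (i + 1) (by omega) hi
  rw [hi1, hi2] at hxy
  -- common factor
  set R : ℝ[X] := ∏ k ∈ ((range n).erase i).erase (i + 1), (X - C (x k)) with hR
  have hmi : i ∈ range n := Finset.mem_range.2 (by omega)
  have hmi1 : i + 1 ∈ (range n).erase i :=
    Finset.mem_erase.2 ⟨by omega, Finset.mem_range.2 hi⟩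
  have hPR : ∏ k ∈ range n, (X - C (x k)) = (X - C (x i)) * ((X - C (x (i + 1))) * R) := by
    rw [← Finset.mul_prod_erase (range n) _ hmi, ← Finset.mul_prod_erase _ _ hmi1]
  have hQR : ∏ k ∈ range n, (X - C (y k)) = (X - C (y i)) * ((X - C (y (i + 1))) * R) := by
    rw [← Finset.mul_prod_erase (range n) _ hmi, ← Finset.mul_prod_erase _ _ hmi1]
    congr 2
    refine Finset.prod_congr rfl fun k hk => ?_
    simp only [Finset.mem_erase] at hk
    rw [hyo k (Finset.mem_range.1 hk.2.2) hk.2.1 hk.1]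
  have hc : 0 < y i * y (i + 1) - x i * x (i + 1) := by rw [hi1, hi2]; nlinarith
  have hkey : ∀ j < n, _ := fun j hj => key_identity R (x i) (x (i + 1)) (y i) (y (i + 1)) lam (u j)
    (by rw [hi1, hi2]; ring) _ _ hPR hQR (hu j hj).2.2
  -- monotonicity helpers
  have hxle : ∀ j k, j ≤ k → k < n → x j ≤ x k := by
    intro j k hjk hk
    rcases hjk.eq_or_lt with h | h
    · rw [h]
    · exact (hx j k h hk).le
  have hyle : ∀ j k, j ≤ k → k < n → y j ≤ y k := by
    intro j k hjk hk
    rcases hjk.eq_or_lt with h | h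
    · rw [h]
    · exact (hy j k h hk).le
  have hQne : ∀ j < n, i ≠ j → R.eval (u j) ≠ 0 := by
    intro j hj hij h0
    have h1 := sign_right hx hj (hu j hj).1 (hu j hj).2.1
    rw [hPR] at h1
    simp [h0] at h1
  have hv : ∀ j, ∃ t, j < n → (y j < t ∧ (j + 1 < n → t < y (j + 1)) ∧
      (j < i → u j ≤ t) ∧ (i < j → t ≤ u j) ∧
      (∏ k ∈ range n, (X - C (y k))
      - C lam * derivative (∏ k ∈ range n, (X - C (y k)))).eval t = 0) := by
    intro j
    by_cases hj : j < n
    swap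
    · exact ⟨0, fun h => absurd h hj⟩
    rcases lt_trichotomy j i with h | h | h
    · -- left of the contraction
      have hyj : y j = x j := hyo j hj (by omega) (by omega)
      have hj1 : x (j + 1) ≤ y (j + 1) := by
        by_cases hh : j + 1 = i
        · rw [hh, hi1]; linarith
        · rw [hyo (j + 1) (by omega) hh (by omega)]
      have hu1 := (hu j hj).1
      have hu2 := (hu j hj).2.1 (by omega)
      have hj2 : x (j + 1) ≤ x i := hxle _ _ h (by omega)
      have hs := sign_left hy (j := j) (by omega) (t := u j) (by linarith) (by linarith)
      have hk := hkey j hj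
      have hR2 : 0 < (R.eval (u j)) ^ 2 := by have := hQne j hj (by omega); positivity
      have hneg : (∏ k ∈ range n, (X - C (y k))
          - C lam * derivative (∏ k ∈ range n, (X - C (y k)))).eval (u j)
          * (∏ k ∈ range n, (X - C (y k))).eval (u j) < 0 := by
        have hA : 0 < (u j - x i) * (u j - x (i + 1)) :=
          mul_pos_of_neg_of_neg (by linarith) (by linarith)
        have hB : 0 < (u j - y i) * (u j - y (i + 1)) :=
          mul_pos_of_neg_of_neg (by linarith) (by linarith)
        have hD : 2 * u j - x i - x (i + 1) < 0 := by linarith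
        have : lam * (y i * y (i + 1) - x i * x (i + 1)) * (2 * u j - x i - x (i + 1)) *
            ((u j - y i) * (u j - y (i + 1))) * (R.eval (u j)) ^ 2 < 0 :=
          mul_neg_of_neg_of_pos (mul_neg_of_neg_of_pos
            (mul_neg_of_pos_of_neg (mul_pos hl hc) hD) hB) hR2
        rw [← hk] at this
        exact (pos_iff_neg_of_mul_neg this).1 hA
      obtain ⟨t, h1, h2, h3⟩ := ivt_aux (∏ k ∈ range n, (X - C (y k))
          - C lam * derivative (∏ k ∈ range n, (X - C (y k)))) (u j) (y (j + 1)) (by linarith) (by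
          rw [eval_pencil_root n y lam (j + 1) (by omega)]
          generalize (∏ k ∈ range n, (X - C (y k))
            - C lam * derivative (∏ k ∈ range n, (X - C (y k)))).eval (u j) = q at *
          generalize (∏ k ∈ range n, (X - C (y k))).eval (u j) = T at *
          generalize (derivative (∏ k ∈ range n, (X - C (y k)))).eval (y (j + 1)) = D at *
          have h4 : 0 < (q * D) * (T * T) := by nlinarith [mul_pos_of_neg_of_neg hneg hs]
          have h5 : 0 < q * D := pos_of_mul_pos_left h4 (mul_self_nonneg T)
          nlinarith [mul_pos hl h5])
      exact ⟨t, fun _ => ⟨by linarith, fun _ => h2, fun _ => h1.le, fun h => by omega, h3⟩⟩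
    · subst h
      obtain ⟨t, h1, h2, h3⟩ := pencil_mid hy hl.ne' hi
      exact ⟨t, fun _ => ⟨h1, fun _ => h2, fun h => by omega, fun h => by omega, h3⟩⟩
    · -- right of the contraction
      have hyj : y j ≤ x j := by
        by_cases hh : j = i + 1
        · rw [hh, hi2]; linarith
        · rw [hyo j hj (by omega) hh]
      have hu1 := (hu j hj).1
      have hu2 : j + 1 < n → u j < y (j + 1) := by
        intro hh
        rw [hyo (j + 1) hh (by omega) (by omega)]
        exact (hu j hj).2.1 hh
      have hj2 : x (i + 1) ≤ x j := hxle _ _ h hj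
      have hs := sign_right hy hj (t := u j) (by linarith) hu2
      have hk := hkey j hj
      have hR2 : 0 < (R.eval (u j)) ^ 2 := by have := hQne j hj (by omega); positivity
      have hpos : 0 < (∏ k ∈ range n, (X - C (y k))
          - C lam * derivative (∏ k ∈ range n, (X - C (y k)))).eval (u j)
          * (∏ k ∈ range n, (X - C (y k))).eval (u j) := by
        have hA : 0 < (u j - x i) * (u j - x (i + 1)) :=
          mul_pos (by linarith) (by linarith)
        have hB : 0 < (u j - y i) * (u j - y (i + 1)) :=
          mul_pos (by linarith) (by linarith)
        have hD : 0 < 2 * u j - x i - x (i + 1) := by linarith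
        have : 0 < lam * (y i * y (i + 1) - x i * x (i + 1)) * (2 * u j - x i - x (i + 1)) *
            ((u j - y i) * (u j - y (i + 1))) * (R.eval (u j)) ^ 2 :=
          mul_pos (mul_pos (mul_pos (mul_pos hl hc) hD) hB) hR2
        rw [← hk] at this
        exact (mul_pos_iff_of_pos_left hA).1 this
      obtain ⟨t, h1, h2, h3⟩ := ivt_aux (∏ k ∈ range n, (X - C (y k))
          - C lam * derivative (∏ k ∈ range n, (X - C (y k)))) (y j) (u j) (by linarith) (by
          rw [eval_pencil_root n y lam j hj]
          generalize (∏ k ∈ range n, (X - C (y k))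
            - C lam * derivative (∏ k ∈ range n, (X - C (y k)))).eval (u j) = q at *
          generalize (∏ k ∈ range n, (X - C (y k))).eval (u j) = T at *
          generalize (derivative (∏ k ∈ range n, (X - C (y k)))).eval (y j) = D at *
          have h4 : 0 < (q * D) * (T * T) := by nlinarith [mul_pos hpos hs]
          have h5 : 0 < q * D := pos_of_mul_pos_left h4 (mul_self_nonneg T)
          nlinarith [mul_pos hl h5])
      exact ⟨t, fun _ => ⟨h1, fun h => h2.trans (hu2 h), fun h => by omega, fun _ => h2.le, h3⟩⟩
  choose v hv using hv
  have hui : SIncr n u := sIncr_of_succ fun j hj =>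
    ((hu j (by omega)).2.1 hj).trans (hu (j + 1) hj).1
  have hvi : SIncr n v := sIncr_of_succ fun j hj =>
    ((hv j (by omega)).2.1 hj).trans (hv (j + 1) hj).1
  have e1 := pencil_eq (by omega) x u lam hui fun j hj => (hu j hj).2.2
  have e2 := pencil_eq (by omega) y v lam hvi fun j hj => (hv j hj).2.2.2.2
  refine ⟨u, v, e1, e2, majorize_aux n i u v (by omega) hvi ?_
    (fun j hj => (hv j (by omega)).2.2.1 hj) (fun j hj h => (hv j hj).2.2.2.1 h)⟩
  rw [sum_roots (by omega) x u lam e1, sum_roots (by omega) y v lam e2]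
  congr 1
  rw [← Finset.add_sum_erase (range n) _ hmi, ← Finset.add_sum_erase _ _ hmi1,
    ← Finset.add_sum_erase (range n) x hmi, ← Finset.add_sum_erase _ x hmi1, hi1, hi2]
  have : ∑ k ∈ ((range n).erase i).erase (i + 1), y k
      = ∑ k ∈ ((range n).erase i).erase (i + 1), x k := by
    refine Finset.sum_congr rfl fun k hk => ?_
    simp only [Finset.mem_erase] at hk
    exact hyo k (Finset.mem_range.1 hk.2.2) hk.2.1 hk.1
  rw [this]; ring

theorem prod_comp_neg (n : ℕ) (w : ℕ → ℝ) :
    (∏ k ∈ range n, (X - C (w k))).comp (-X) = C ((-1) ^ n) * ∏ k ∈ range n, (X - C (-w k)) := by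
  rw [Polynomial.prod_comp]
  have : ∀ k ∈ range n, (X - C (w k)).comp (-X) = (-1 : ℝ[X]) * (X - C (-w k)) := by
    intro k _
    simp only [sub_comp, X_comp, C_comp, map_neg]; ring
  rw [Finset.prod_congr rfl this, Finset.prod_mul_distrib]
  simp

theorem reflect_pencil (n : ℕ) (x u : ℕ → ℝ) (lam : ℝ)
    (h : ∏ k ∈ range n, (X - C (-x (n - 1 - k)))
      - C (-lam) * derivative (∏ k ∈ range n, (X - C (-x (n - 1 - k))))
        = ∏ j ∈ range n, (X - C (u j))) :
    ∏ k ∈ range n, (X - C (x k)) - C lam * derivative (∏ k ∈ range n, (X - C (x k)))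
      = ∏ j ∈ range n, (X - C (-u j)) := by
  rw [Finset.prod_range_reflect (fun k => X - C (-x k)) n] at h
  have h1 := congrArg (fun p => p.comp (-X)) h
  simp only [sub_comp, mul_comp, C_comp] at h1
  have h2 := derivative_comp (∏ k ∈ range n, (X - C (-x k))) (-X)
  rw [prod_comp_neg] at h1 h2
  rw [prod_comp_neg] at h1
  simp only [neg_neg, derivative_mul, derivative_C, zero_mul, zero_add, derivative_neg,
    derivative_X] at h1 h2
  have hne : (C ((-1 : ℝ) ^ n)) ≠ 0 := by simp
  apply mul_left_cancel₀ hne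
  rw [← h1]
  rw [show C (-lam) = -C lam from map_neg _ _]
  linear_combination (-C lam) * h2

/-- Proposition (simplecontr): if `Q` is a simple nondegenerate contraction of a strictly
hyperbolic `P`, then the roots of `Q - λQ'` are majorized by the roots of `P - λP'`
for every real `λ`. -/
theorem simple_contraction_pencil_majorized
    (n : ℕ) (hn : 2 ≤ n) (x y : ℕ → ℝ) (i : ℕ) (hi : i + 1 < n)
    (hx : ∀ j, j + 1 < n → x j < x (j + 1))
    (σ : ℝ) (hσ0 : 0 < σ) (hσ : σ < (x (i + 1) - x i) / 2)
    (hy : y = fun j => if j = i then x i + σ else if j = i + 1 then x (i + 1) - σ else x j)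
    (P Q : Polynomial ℝ)
    (hP : P = ∏ j ∈ Finset.range n, (X - C (x j)))
    (hQ : Q = ∏ j ∈ Finset.range n, (X - C (y j))) :
    ∀ lam : ℝ, ∃ u v : ℕ → ℝ,
      P - C lam * derivative P = ∏ j ∈ Finset.range n, (X - C (u j)) ∧
      Q - C lam * derivative Q = ∏ j ∈ Finset.range n, (X - C (v j)) ∧
      MajorizedOn n v u := by
  intro lam
  subst hP hQ
  have hi1 : y i = x i + σ := by simp [hy]
  have hi2 : y (i + 1) = x (i + 1) - σ := by simp [hy]
  have hyo : ∀ j, j ≠ i → j ≠ i + 1 → y j = x j := by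
    intro j h1 h2; simp [hy, h1, h2]
  clear hy
  have hx' : SIncr n x := sIncr_of_succ hx
  have hy' : SIncr n y := by
    refine sIncr_of_succ fun j hj => ?_
    have h0 := hx j hj
    by_cases h1 : j = i
    · subst h1; rw [hi1, hi2]; linarith
    by_cases h2 : j = i + 1
    · subst h2; rw [hi2, hyo _ (by omega) (by omega)]; linarith
    rw [hyo j h1 h2]
    by_cases h3 : j + 1 = i
    · rw [h3, hi1, ← h3]; linarith
    · rw [hyo (j + 1) h3 (by omega)]; exact h0
  rcases lt_trichotomy lam 0 with hl | hl | hl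
  · obtain ⟨u, v, h1, h2, h3⟩ := pos_case_s17 n (fun k => -x (n - 1 - k)) (fun k => -y (n - 1 - k))
      (n - 2 - i) (by omega)
      (fun j k hjk hk => neg_lt_neg (hx' _ _ (by omega) (by omega)))
      (fun j k hjk hk => neg_lt_neg (hy' _ _ (by omega) (by omega))) σ hσ0
      (by
        have : n - 1 - (n - 2 - i) = i + 1 := by omega
        simp only [this, hi2]; ring)
      (by
        have : n - 1 - (n - 2 - i + 1) = i := by omega
        simp only [this, hi1]; ring)
      (by
        intro j hj h1 h2
        simp only [hyo (n - 1 - j) (by omega) (by omega)])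
      (-lam) (by linarith)
    refine ⟨fun j => -u j, fun j => -v j, reflect_pencil n x u lam h1, reflect_pencil n y v lam h2,
      ?_⟩
    intro f hf
    refine h3 (fun t => f (-t)) ?_
    have := hf.comp_linearMap (-LinearMap.id : ℝ →ₗ[ℝ] ℝ)
    simpa [Function.comp_def] using this
  · subst hl
    refine ⟨x, y, by simp, by simp, majorize_aux n i x y (by omega) hy' ?_ ?_ ?_⟩
    · have hmi : i ∈ range n := Finset.mem_range.2 (by omega)
      have hmi1 : i + 1 ∈ (range n).erase i :=
        Finset.mem_erase.2 ⟨by omega, Finset.mem_range.2 hi⟩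
      rw [← Finset.add_sum_erase (range n) _ hmi, ← Finset.add_sum_erase _ _ hmi1,
        ← Finset.add_sum_erase (range n) x hmi, ← Finset.add_sum_erase _ x hmi1, hi1, hi2]
      have : ∑ k ∈ ((range n).erase i).erase (i + 1), y k
          = ∑ k ∈ ((range n).erase i).erase (i + 1), x k := by
        refine Finset.sum_congr rfl fun k hk => ?_
        simp only [Finset.mem_erase] at hk
        exact hyo k hk.2.1 hk.1
      rw [this]; ring
    · intro j hj
      rw [hyo j (by omega) (by omega)]
    · intro j hj h
      by_cases hh : j = i + 1
      · rw [hh, hi2]; linarith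
      · rw [hyo j (by omega) hh]
  · exact pos_case_s17 n x y i hi hx' hy' σ hσ0 hi1 hi2 (fun j _ => hyo j) lam hl
end
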